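/- Let R be a standard graded ring of dimension d ≥ 2 over a perfect field of characteristic p, I a homogeneous ideal of finite colength, M a finitely generated graded R-module, and Λ the set of minimal primes P of R with dim R/P = d. Then the HK density function is additive: HKd(M, I) = Σ_{P ∈ Λ} ℓ_{R_P}(M_P) · HKd(R/P, I), as functions ℝ → ℝ. -/

import Mathlib

open Filter Topology

/-- The `q`-th Frobenius power `I^{[q]}` of an ideal. -/
def frobeniusPower {R : Type*} [CommRing R] (I : Ideal R) (q : ℕ) : Ideal R :=
  Ideal.span ((fun x => x ^ q) '' (I : Set R))

/-- `ℓ(M/I^{[q]}M)_m`. -/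
noncomputable def gradedPieceLength {k R M : Type*} [Field k] [CommRing R] [Algebra k R]
    [AddCommGroup M] [Module R M] [Module k M] [IsScalarTower k R M]
    (ℳ : ℕ → Submodule k M) (I : Ideal R) (q m : ℕ) : ℕ :=
  Module.finrank k
    ((ℳ m).map ((frobeniusPower I q • (⊤ : Submodule R M)).mkQ.restrictScalars k))

/-- `ℓ((R/P)/(I^{[q]}(R/P)))_m`: the degree-`m` piece of the quotient ring `R/P` modulo
the Frobenius power of `I`, realized as the image of `𝒜 m` in `R/(P + I^{[q]})`. -/
noncomputable def quotGradedPieceLength {k R : Type*} [Field k] [CommRing R] [Algebra k R]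
    (𝒜 : ℕ → Submodule k R) (P I : Ideal R) (q m : ℕ) : ℕ :=
  Module.finrank k
    ((𝒜 m).map (Ideal.Quotient.mkₐ k (P ⊔ frobeniusPower I q)).toLinearMap)

open Module in
/-- The dimension of the image of `X` in `V ⧸ N`. -/
noncomputable def relRank {k V : Type*} [Field k] [AddCommGroup V] [Module k V]
    (N X : Submodule k V) : ℕ :=
  Module.finrank k (X.map N.mkQ)

section RelRank

open Module

variable {k V W : Type*} [Field k] [AddCommGroup V] [Module k V] [AddCommGroup W] [Module k W]

lemma relRank_mono {N X Y : Submodule k V} [FiniteDimensional k Y] (h : X ≤ Y) :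
    relRank N X ≤ relRank N Y :=
  Submodule.finrank_mono (Submodule.map_mono h)

lemma relRank_le_finrank (N X : Submodule k V) [FiniteDimensional k X] :
    relRank N X ≤ finrank k X :=
  Submodule.finrank_map_le _ _

lemma relRank_sup_le (N X Y : Submodule k V) [FiniteDimensional k X] [FiniteDimensional k Y] :
    relRank N (X ⊔ Y) ≤ relRank N X + relRank N Y := by
  unfold relRank
  rw [Submodule.map_sup]
  exact Submodule.finrank_add_le_finrank_add_finrank _ _

lemma finrank_iSup_le_sum {ι : Type*} [Fintype ι] (X : ι → Submodule k V)
    [∀ i, FiniteDimensional k (X i)] :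
    finrank k (⨆ i, X i : Submodule k V) ≤ ∑ i, finrank k (X i) := by
  classical
  rw [← Finset.sup_univ_eq_iSup]
  suffices h : ∀ s : Finset ι, FiniteDimensional k (s.sup X : Submodule k V) ∧
      finrank k (s.sup X : Submodule k V) ≤ ∑ i ∈ s, finrank k (X i) from (h _).2
  intro s
  induction s using Finset.induction_on with
  | empty => exact ⟨by rw [Finset.sup_empty]; infer_instance, by simp⟩
  | insert a s ha ih =>
    obtain ⟨h1, h2⟩ := ih
    rw [Finset.sup_insert, Finset.sum_insert ha]
    exact ⟨inferInstance,
      (Submodule.finrank_add_le_finrank_add_finrank _ _).trans (Nat.add_le_add_left h2 _)⟩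

lemma relRank_anti {N N' X : Submodule k V} [FiniteDimensional k X] (h : N ≤ N') :
    relRank N' X ≤ relRank N X := by
  have : X.map N'.mkQ = (X.map N.mkQ).map (Submodule.factor h) := by
    rw [← Submodule.map_comp]
    congr 1
  unfold relRank
  rw [this]
  exact Submodule.finrank_map_le _ _

lemma finrank_map_eq_of_ker_eq {W' : Type*} [AddCommGroup W'] [Module k W'] (f : V →ₗ[k] W)
    (g : V →ₗ[k] W') (h : LinearMap.ker f = LinearMap.ker g) (X : Submodule k V) :
    finrank k (X.map f) = finrank k (X.map g) := by
  have key : ∀ {U : Type _} [AddCommGroup U] [Module k U] (f : V →ₗ[k] U),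
      finrank k (X.map f) = finrank k (X ⧸ LinearMap.ker (f.domRestrict X)) := by
    intro U _ _ f
    rw [← LinearMap.range_domRestrict]
    exact (LinearMap.quotKerEquivRange (f.domRestrict X)).symm.finrank_eq
  have key' : finrank k (X.map g) = finrank k (X ⧸ LinearMap.ker (g.domRestrict X)) := by
    rw [← LinearMap.range_domRestrict]
    exact (LinearMap.quotKerEquivRange (g.domRestrict X)).symm.finrank_eq
  rw [key, key']
  have : LinearMap.ker (f.domRestrict X) = LinearMap.ker (g.domRestrict X) := by
    rw [LinearMap.ker_domRestrict, LinearMap.ker_domRestrict, h]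
  rw [this]

lemma relRank_map (N : Submodule k W) (f : V →ₗ[k] W) (X : Submodule k V) :
    relRank N (X.map f) = relRank (N.comap f) X := by
  unfold relRank
  rw [← Submodule.map_comp]
  apply finrank_map_eq_of_ker_eq
  rw [LinearMap.ker_comp, Submodule.ker_mkQ, Submodule.ker_mkQ]

lemma relRank_eq_finrank {N X : Submodule k V} (h : Disjoint X N) :
    relRank N X = finrank k X := by
  unfold relRank
  have : Function.Injective (N.mkQ.domRestrict X) := by
    rw [← LinearMap.ker_eq_bot, LinearMap.ker_domRestrict, Submodule.ker_mkQ]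
    rw [← Submodule.disjoint_iff_comap_eq_bot]
    exact h
  rw [← LinearMap.range_domRestrict]
  exact LinearMap.finrank_range_of_inj this

lemma relRank_eq_zero {N X : Submodule k V} (h : X ≤ N) : relRank N X = 0 := by
  unfold relRank
  have : X.map N.mkQ = ⊥ := by
    rw [eq_bot_iff]
    calc X.map N.mkQ ≤ N.map N.mkQ := Submodule.map_mono h
      _ = ⊥ := Submodule.mkQ_map_self N
  rw [this, finrank_bot]

lemma relRank_superadd {N N' X Z : Submodule k V} [FiniteDimensional k Z] (hXZ : X ≤ Z)
    (hX : X ≤ N') (hN : N ≤ N') : relRank N X + relRank N' Z ≤ relRank N Z := by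
  unfold relRank
  have e : Z.map N'.mkQ = (Z.map N.mkQ).map (Submodule.factor hN) := by
    rw [← Submodule.map_comp]
    congr 1
  have h := ((Submodule.factor hN).domRestrict (Z.map N.mkQ)).finrank_range_add_finrank_ker
  rw [LinearMap.range_domRestrict, ← e] at h
  have hle : X.map N.mkQ ≤ Z.map N.mkQ := Submodule.map_mono hXZ
  have h2 : (X.map N.mkQ).comap (Z.map N.mkQ).subtype ≤
      LinearMap.ker ((Submodule.factor hN).domRestrict (Z.map N.mkQ)) := by
    rintro ⟨_, _⟩ ⟨x, hx, rfl⟩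
    rw [LinearMap.mem_ker]
    exact (Submodule.Quotient.mk_eq_zero _).mpr (hX hx)
  have h3 := Submodule.finrank_mono h2
  rw [(Submodule.comapSubtypeEquivOfLe hle).finrank_eq] at h3
  lia

lemma exists_isCompl_relRank (N X : Submodule k V) [FiniteDimensional k X] :
    ∃ Z : Submodule k V, FiniteDimensional k Z ∧ X = (X ⊓ N) ⊔ Z ∧ finrank k Z = relRank N X := by
  obtain ⟨Z, hZ⟩ := Submodule.exists_isCompl ((X ⊓ N).comap X.subtype)
  have h1 : X = (X ⊓ N) ⊔ Z.map X.subtype := by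
    have := congrArg (Submodule.map X.subtype) hZ.sup_eq_top
    rw [Submodule.map_sup, Submodule.map_comap_subtype, Submodule.map_subtype_top] at this
    rwa [inf_of_le_right inf_le_left, eq_comm] at this
  have hd : Disjoint (Z.map X.subtype) N := by
    rw [Submodule.disjoint_def]
    rintro _ ⟨z, hz, rfl⟩ hN
    have := Submodule.disjoint_def.mp hZ.disjoint z ⟨z.2, hN⟩ hz
    simp [this]
  refine ⟨Z.map X.subtype, inferInstance, h1, ?_⟩
  rw [← relRank_eq_finrank hd]
  apply le_antisymm
  · exact relRank_mono (Submodule.map_subtype_le _ _)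
  · conv_lhs => rw [h1]
    refine (relRank_sup_le _ _ _).trans ?_
    rw [relRank_eq_zero inf_le_right, zero_add]

end RelRank

section Graded

open DirectSum Module

variable {k A V : Type*} [Field k] [CommRing A] [Algebra k A] [AddCommGroup V] [Module A V]
  [Module k V]

/-- The `k`-linear projection onto the `n`-th graded piece. -/
noncomputable def gradedProj (𝒱 : ℕ → Submodule k V) [Decomposition 𝒱] (n : ℕ) : V →ₗ[k] V :=
  (𝒱 n).subtype ∘ₗ DirectSum.component k ℕ (fun i => 𝒱 i) n ∘ₗ
    (decomposeLinearEquiv 𝒱).toLinearMap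

section Proj

variable (𝒱 : ℕ → Submodule k V) [Decomposition 𝒱]

lemma gradedProj_apply (n : ℕ) (v : V) : gradedProj 𝒱 n v = (decompose 𝒱 v n : V) := rfl

lemma gradedProj_mem (n : ℕ) (v : V) : gradedProj 𝒱 n v ∈ 𝒱 n := (decompose 𝒱 v n).2

lemma gradedProj_of_mem {n : ℕ} {v : V} (h : v ∈ 𝒱 n) : gradedProj 𝒱 n v = v :=
  decompose_of_mem_same 𝒱 h

lemma gradedProj_of_mem_ne {m n : ℕ} {v : V} (h : v ∈ 𝒱 m) (hmn : m ≠ n) :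
    gradedProj 𝒱 n v = 0 :=
  decompose_of_mem_ne 𝒱 h hmn

lemma exists_sum_gradedProj (v : V) :
    ∃ s : Finset ℕ, v = ∑ n ∈ s, gradedProj 𝒱 n v ∧ ∀ n ∉ s, gradedProj 𝒱 n v = 0 := by
  classical
  refine ⟨(decompose 𝒱 v).support, (sum_support_decompose 𝒱 v).symm, fun n hn => ?_⟩
  rw [gradedProj_apply]
  simpa [DFinsupp.mem_support_iff] using hn

lemma graded_induction {motive : V → Prop} (v : V) (zero : motive 0)
    (add : ∀ x y, motive x → motive y → motive (x + y))
    (hom : ∀ n, ∀ x ∈ 𝒱 n, motive x) : motive v := by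
  obtain ⟨s, hs, -⟩ := exists_sum_gradedProj 𝒱 v
  rw [hs]
  exact Finset.sum_induction _ _ add zero fun n _ => hom n _ (gradedProj_mem 𝒱 n v)

end Proj

section Action

lemma gradedSMul_mem (𝒜 : ℕ → Submodule k A) (𝒱 : ℕ → Submodule k V) [SetLike.GradedSMul 𝒜 𝒱]
    {i n : ℕ} {a : A} {v : V} (ha : a ∈ 𝒜 i) (hv : v ∈ 𝒱 n) : a • v ∈ 𝒱 (i + n) :=
  SetLike.GradedSMul.smul_mem ha hv

lemma isHomogeneous_sup {A V : Type*} [CommRing A] [AddCommGroup V] [Module A V] [Module k V]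
    (𝒱 : ℕ → Submodule k V) [Decomposition 𝒱] {N N' : Submodule A V} (hN : N.IsHomogeneous 𝒱)
    (hN' : N'.IsHomogeneous 𝒱) : (N ⊔ N').IsHomogeneous 𝒱 := by
  intro n v hv
  obtain ⟨x, hx, y, hy, rfl⟩ := Submodule.mem_sup.mp hv
  rw [← gradedProj_apply, map_add]
  exact Submodule.add_mem_sup (hN n hx) (hN' n hy)

lemma gradedProj_smul_of_le (𝒜 : ℕ → Submodule k A) (𝒱 : ℕ → Submodule k V)
    [Decomposition 𝒱] [SetLike.GradedSMul 𝒜 𝒱] {i n : ℕ} {a : A} (ha : a ∈ 𝒜 i) (h : i ≤ n) (v : V) :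
    gradedProj 𝒱 n (a • v) = a • gradedProj 𝒱 (n - i) v := by
  refine graded_induction 𝒱 (motive := fun v => gradedProj 𝒱 n (a • v) =
    a • gradedProj 𝒱 (n - i) v) v (by simp) (fun x y hx hy => by simp [hx, hy]) fun m x hx => ?_
  have h1 := gradedSMul_mem 𝒜 𝒱 ha hx
  by_cases hm : i + m = n
  · subst hm
    rw [gradedProj_of_mem 𝒱 h1, Nat.add_sub_cancel_left, gradedProj_of_mem 𝒱 hx]
  · rw [gradedProj_of_mem_ne 𝒱 h1 hm, gradedProj_of_mem_ne 𝒱 hx (by lia), smul_zero]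

variable (𝒜 : ℕ → Submodule k A) [GradedAlgebra 𝒜] (𝒱 : ℕ → Submodule k V) [Decomposition 𝒱]
  [SetLike.GradedSMul 𝒜 𝒱]

lemma gradedProj_smul_right_of_le {c n : ℕ} {u : V} (hu : u ∈ 𝒱 c) (h : c ≤ n) (a : A) :
    gradedProj 𝒱 n (a • u) = gradedProj 𝒜 (n - c) a • u := by
  refine graded_induction 𝒜 (motive := fun a => gradedProj 𝒱 n (a • u) =
    gradedProj 𝒜 (n - c) a • u) a (by simp) (fun x y hx hy => by simp [add_smul, hx, hy])
    fun m x hx => ?_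
  have h1 := gradedSMul_mem 𝒜 𝒱 hx hu
  by_cases hm : m + c = n
  · subst hm
    rw [gradedProj_of_mem 𝒱 h1, Nat.add_sub_cancel, gradedProj_of_mem 𝒜 hx]
  · rw [gradedProj_of_mem_ne 𝒱 h1 hm, gradedProj_of_mem_ne 𝒜 hx (by lia), zero_smul]

lemma gradedProj_smul_right_of_lt (𝒜 : ℕ → Submodule k A) [GradedAlgebra 𝒜]
    (𝒱 : ℕ → Submodule k V) [Decomposition 𝒱] [SetLike.GradedSMul 𝒜 𝒱]
    {c n : ℕ} {u : V} (hu : u ∈ 𝒱 c) (h : n < c) (a : A) :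
    gradedProj 𝒱 n (a • u) = 0 := by
  refine graded_induction 𝒜 (motive := fun a => gradedProj 𝒱 n (a • u) = 0) a (by simp)
    (fun x y hx hy => by simp [add_smul, hx, hy]) fun m x hx => ?_
  exact gradedProj_of_mem_ne 𝒱 (gradedSMul_mem 𝒜 𝒱 hx hu) (by lia)

/-- The ideal of elements `a` with `a • u ∈ N`. -/
def annModulo (N : Submodule A V) (u : V) : Ideal A :=
  N.comap (LinearMap.toSpanSingleton A V u)

lemma mem_annModulo {N : Submodule A V} {u : V} {a : A} : a ∈ annModulo N u ↔ a • u ∈ N := Iff.rfl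

lemma isHomogeneous_span_singleton (𝒜 : ℕ → Submodule k A) [GradedAlgebra 𝒜]
    (𝒱 : ℕ → Submodule k V) [Decomposition 𝒱] [SetLike.GradedSMul 𝒜 𝒱]
    {c : ℕ} {u : V} (hu : u ∈ 𝒱 c) :
    (Submodule.span A {u}).IsHomogeneous 𝒱 := by
  intro n v hv
  obtain ⟨a, rfl⟩ := Submodule.mem_span_singleton.mp hv
  rw [← gradedProj_apply]
  by_cases h : c ≤ n
  · rw [gradedProj_smul_right_of_le 𝒜 𝒱 hu h]
    exact Submodule.smul_mem _ _ (Submodule.mem_span_singleton_self u)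
  · rw [gradedProj_smul_right_of_lt 𝒜 𝒱 hu (by lia)]
    exact zero_mem _

lemma annModulo_isHomogeneous {N : Submodule A V} (hN : N.IsHomogeneous 𝒱) {c : ℕ} {u : V}
    (hu : u ∈ 𝒱 c) : (annModulo N u).IsHomogeneous 𝒜 := by
  intro n a ha
  rw [← gradedProj_apply, mem_annModulo]
  have := hN (n + c) (mem_annModulo.mp ha)
  rw [← gradedProj_apply, gradedProj_smul_right_of_le 𝒜 𝒱 hu (by lia), Nat.add_sub_cancel] at this
  exact this

lemma exists_isPrime_annModulo (𝒜 : ℕ → Submodule k A) [GradedAlgebra 𝒜]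
    (𝒱 : ℕ → Submodule k V) [Decomposition 𝒱] [SetLike.GradedSMul 𝒜 𝒱]
    [IsNoetherianRing A] {N' N : Submodule A V}
    (hN' : N'.IsHomogeneous 𝒱) (hN : N.IsHomogeneous 𝒱) (h : ¬ N ≤ N') :
    ∃ c u, u ∈ 𝒱 c ∧ u ∈ N ∧ u ∉ N' ∧ (annModulo N' u).IsPrime := by
  let S : Set (Ideal A) := {I | ∃ c u, u ∈ 𝒱 c ∧ u ∈ N ∧ u ∉ N' ∧ I = annModulo N' u}
  have hS : S.Nonempty := by
    obtain ⟨v, hv, hv'⟩ := Set.not_subset.mp h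
    have : ∃ n, gradedProj 𝒱 n v ∉ N' := by
      by_contra! hc
      exact hv' ((Submodule.IsHomogeneous.mem_iff 𝒱 hN').mpr hc)
    obtain ⟨n, hn⟩ := this
    exact ⟨_, n, gradedProj 𝒱 n v, gradedProj_mem 𝒱 n v, hN n hv, hn, rfl⟩
  obtain ⟨I, ⟨c, u, huc, huN, huN', rfl⟩, hmax⟩ :=
    set_has_maximal_iff_noetherian.mpr (inferInstance : IsNoetherian A A) S hS
  refine ⟨c, u, huc, huN, huN', ?_⟩
  refine (annModulo_isHomogeneous 𝒜 𝒱 hN' huc).isPrime_of_homogeneous_mem_or_mem ?_ ?_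
  · rw [Ideal.ne_top_iff_one, mem_annModulo, one_smul]
    exact huN'
  · rintro x y ⟨i, hx⟩ ⟨j, hy⟩ hxy
    by_contra! hc
    rw [mem_annModulo, mem_annModulo] at hc
    have hle : annModulo N' u ≤ annModulo N' (y • u) := fun a ha => by
      rw [mem_annModulo, smul_comm]
      exact N'.smul_mem _ ha
    have hlt : annModulo N' u < annModulo N' (y • u) := by
      refine lt_of_le_of_ne hle fun he => hc.1 ?_
      have : x ∈ annModulo N' (y • u) := by
        rw [mem_annModulo, smul_smul]; exact hxy
      rw [← he] at this
      exact this
    exact hmax _ ⟨_, y • u, gradedSMul_mem 𝒜 𝒱 hy huc, N.smul_mem _ huN, hc.2, rfl⟩ hlt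

theorem graded_devissage [IsNoetherianRing A] [Module.Finite A V] {N₁ N : Submodule A V}
    (h₁ : N₁.IsHomogeneous 𝒱) (h : N.IsHomogeneous 𝒱) (hle : N₁ ≤ N)
    (motive : Submodule A V → Prop) (base : motive N₁)
    (step : ∀ (N' : Submodule A V) (c : ℕ) (u : V), N₁ ≤ N' → N' ⊔ Submodule.span A {u} ≤ N →
      N'.IsHomogeneous 𝒱 → u ∈ 𝒱 c → (annModulo N' u).IsPrime →
      (annModulo N' u).IsHomogeneous 𝒜 → motive N' → motive (N' ⊔ Submodule.span A {u})) :
    motive N := by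
  let S : Set (Submodule A V) := {N' | N₁ ≤ N' ∧ N' ≤ N ∧ N'.IsHomogeneous 𝒱 ∧ motive N'}
  obtain ⟨N', ⟨h1, h2, h3, h4⟩, hmax⟩ :=
    set_has_maximal_iff_noetherian.mpr (inferInstance : IsNoetherian A V) S
      ⟨N₁, le_rfl, hle, h₁, base⟩
  by_cases hN : N ≤ N'
  · rwa [le_antisymm hN h2]
  · exfalso
    obtain ⟨c, u, huc, huN, huN', hp⟩ := exists_isPrime_annModulo 𝒜 𝒱 h3 h hN
    have hle' : N' ⊔ Submodule.span A {u} ≤ N :=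
      sup_le h2 ((Submodule.span_singleton_le_iff_mem _ _).mpr huN)
    refine hmax (N' ⊔ Submodule.span A {u}) ⟨h1.trans le_sup_left, hle', ?_, ?_⟩ ?_
    · exact isHomogeneous_sup 𝒱 h3 (isHomogeneous_span_singleton 𝒜 𝒱 huc)
    · exact step N' c u h1 hle' h3 huc hp (annModulo_isHomogeneous 𝒜 𝒱 h3 huc) h4
    · refine lt_of_le_of_ne le_sup_left fun he => huN' ?_
      rw [he]
      exact Submodule.mem_sup_right (Submodule.mem_span_singleton_self u)

end Action

end Graded

section GradedSpan

open DirectSum Module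

variable {k B V ι : Type*} [Field k] [CommRing B] [Algebra k B] [AddCommGroup V] [Module B V]
  [Module k V] [IsScalarTower k B V]

/-- The span of the subspaces `β i • (𝒱 (t i) ⊓ N)`. -/
def gradedSpan (𝒱 : ℕ → Submodule k V) (β : ι → B) (t : ι → ℕ) (N : Submodule k V) :
    Submodule k V :=
  ⨆ i, (𝒱 (t i) ⊓ N).map (Algebra.lsmul k k V (β i))

variable {𝒱 : ℕ → Submodule k V} {β : ι → B} {t : ι → ℕ}

lemma gradedSpan_mono {N N' : Submodule k V} (h : N ≤ N') :
    gradedSpan 𝒱 β t N ≤ gradedSpan 𝒱 β t N' :=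
  iSup_mono fun _ => Submodule.map_mono (inf_le_inf_left _ h)

lemma gradedSpan_le (N : Submodule B V) :
    gradedSpan 𝒱 β t (N.restrictScalars k) ≤ N.restrictScalars k := by
  refine iSup_le fun i => ?_
  rintro _ ⟨v, hv, rfl⟩
  exact N.smul_mem _ hv.2

instance [Finite ι] [∀ n, FiniteDimensional k (𝒱 n)] (N : Submodule k V) :
    FiniteDimensional k (gradedSpan 𝒱 β t N) := by
  unfold gradedSpan
  infer_instance

lemma relRank_le_add (N N' X : Submodule k V) [FiniteDimensional k X] :
    relRank N X ≤ relRank N' X + relRank N (X ⊓ N') := by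
  obtain ⟨Z, hZ, hX, hr⟩ := exists_isCompl_relRank N' X
  calc relRank N X = relRank N ((X ⊓ N') ⊔ Z) := by rw [← hX]
    _ ≤ relRank N (X ⊓ N') + relRank N Z := relRank_sup_le _ _ _
    _ ≤ relRank N (X ⊓ N') + finrank k Z := Nat.add_le_add_left (relRank_le_finrank _ _) _
    _ = _ := by rw [hr, add_comm]

theorem relRank_gradedSpan_le [Fintype ι] [∀ n, FiniteDimensional k (𝒱 n)]
    (N N' N₀ : Submodule k V) :
    relRank N₀ (gradedSpan 𝒱 β t N) ≤
      relRank N₀ (gradedSpan 𝒱 β t N') + ∑ i, relRank N' (𝒱 (t i) ⊓ N) := by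
  choose Z hZ hX hr using fun i => exists_isCompl_relRank N' (𝒱 (t i) ⊓ N)
  have hle : gradedSpan 𝒱 β t N ≤
      gradedSpan 𝒱 β t N' ⊔ ⨆ i, (Z i).map (Algebra.lsmul k k V (β i)) := by
    refine iSup_le fun i => ?_
    rw [hX i, Submodule.map_sup]
    refine sup_le_sup ?_ (le_iSup (fun i => (Z i).map (Algebra.lsmul k k V (β i))) i)
    refine le_trans (Submodule.map_mono ?_)
      (le_iSup (fun i => (𝒱 (t i) ⊓ N').map (Algebra.lsmul k k V (β i))) i)
    exact le_inf (inf_le_left.trans inf_le_left) inf_le_right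
  refine (relRank_mono hle).trans ((relRank_sup_le _ _ _).trans (Nat.add_le_add_left ?_ _))
  refine (relRank_le_finrank _ _).trans ((finrank_iSup_le_sum _).trans ?_)
  refine Finset.sum_le_sum fun i _ => ?_
  rw [← hr i]
  exact Submodule.finrank_map_le _ _

theorem relRank_gradedSpan_superadd [Finite ι] [∀ n, FiniteDimensional k (𝒱 n)]
    {N₀ N : Submodule k V} {N' : Submodule B V} (h₀ : N₀ ≤ N'.restrictScalars k)
    (h : N'.restrictScalars k ≤ N) :
    relRank N₀ (gradedSpan 𝒱 β t (N'.restrictScalars k)) +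
      relRank (N'.restrictScalars k) (gradedSpan 𝒱 β t N) ≤ relRank N₀ (gradedSpan 𝒱 β t N) :=
  relRank_superadd (gradedSpan_mono h) (gradedSpan_le N') h₀

end GradedSpan

section Cyclic

open DirectSum Module

variable {k A V : Type*} [Field k] [CommRing A] [Algebra k A] [AddCommGroup V] [Module A V]
  [Module k V] [IsScalarTower k A V]
  (𝒜 : ℕ → Submodule k A) [GradedAlgebra 𝒜] (𝒱 : ℕ → Submodule k V) [Decomposition 𝒱]
  [SetLike.GradedSMul 𝒜 𝒱]

/-- The part of degree `n` of `A(-c)`. -/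
def shiftPiece (c n : ℕ) : Submodule k A := if c ≤ n then 𝒜 (n - c) else ⊥

instance [∀ n, FiniteDimensional k (𝒜 n)] (c n : ℕ) :
    FiniteDimensional k (shiftPiece 𝒜 c n) := by
  by_cases h : c ≤ n
  · rw [shiftPiece, if_pos h]
    infer_instance
  · rw [shiftPiece, if_neg h]
    infer_instance

lemma inf_sup_span_singleton {N : Submodule A V} (hN : N.IsHomogeneous 𝒱) {c : ℕ} {u : V}
    (hu : u ∈ 𝒱 c) (n : ℕ) :
    𝒱 n ⊓ (N ⊔ Submodule.span A {u}).restrictScalars k = (𝒱 n ⊓ N.restrictScalars k) ⊔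
      (shiftPiece 𝒜 c n).map ((LinearMap.toSpanSingleton A V u).restrictScalars k) := by
  apply le_antisymm
  · rintro v ⟨hv, hv'⟩
    obtain ⟨x, hx, y, hy, rfl⟩ := Submodule.mem_sup.mp hv'
    obtain ⟨a, rfl⟩ := Submodule.mem_span_singleton.mp hy
    rw [← gradedProj_of_mem 𝒱 hv, map_add]
    refine Submodule.add_mem_sup ⟨gradedProj_mem 𝒱 n x, hN n hx⟩ ?_
    unfold shiftPiece
    split_ifs with h
    · rw [gradedProj_smul_right_of_le 𝒜 𝒱 hu h]
      exact ⟨_, gradedProj_mem 𝒜 _ a, rfl⟩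
    · rw [gradedProj_smul_right_of_lt 𝒜 𝒱 hu (by lia)]
      exact zero_mem _
  · refine sup_le (inf_le_inf_left _ fun x hx => Submodule.mem_sup_left hx) ?_
    rintro _ ⟨a, ha, rfl⟩
    unfold shiftPiece at ha
    split_ifs at ha with h
    · refine ⟨?_, Submodule.mem_sup_right
        (Submodule.smul_mem _ _ (Submodule.mem_span_singleton_self u))⟩
      have := gradedSMul_mem 𝒜 𝒱 ha hu
      rwa [Nat.sub_add_cancel h] at this
    · rw [(Submodule.mem_bot k).mp ha, map_zero]
      exact zero_mem _

lemma relRank_map_toSpanSingleton (N : Submodule A V) (u : V) (X : Submodule k A) :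
    relRank (N.restrictScalars k)
      (X.map ((LinearMap.toSpanSingleton A V u).restrictScalars k)) =
      relRank ((annModulo N u).restrictScalars k) X :=
  relRank_map _ _ _

lemma relRank_sup_of_le {W : Type*} [AddCommGroup W] [Module k W] {N X Y : Submodule k W}
    (h : X ≤ N) : relRank N (X ⊔ Y) = relRank N Y := by
  unfold relRank
  rw [Submodule.map_sup]
  have : X.map N.mkQ = ⊥ := by
    rw [eq_bot_iff]
    exact (Submodule.map_mono h).trans (Submodule.mkQ_map_self N).le
  rw [this, bot_sup_eq]

lemma relRank_inf_sup_span_singleton {N : Submodule A V} (hN : N.IsHomogeneous 𝒱) {c : ℕ}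
    {u : V} (hu : u ∈ 𝒱 c) (n : ℕ) :
    relRank (N.restrictScalars k) (𝒱 n ⊓ (N ⊔ Submodule.span A {u}).restrictScalars k) =
      relRank ((annModulo N u).restrictScalars k) (shiftPiece 𝒜 c n) := by
  rw [inf_sup_span_singleton 𝒜 𝒱 hN hu, relRank_sup_of_le inf_le_right,
    relRank_map_toSpanSingleton]

section Algebra

variable {ι B : Type*} [CommRing B] [Algebra k B] [Module B V] [IsScalarTower k B V] [Algebra B A]
  [IsScalarTower B A V] [IsScalarTower k B A] (β : ι → B) (t : ι → ℕ)

lemma gradedSpan_sup_span_singleton {N : Submodule A V} (hN : N.IsHomogeneous 𝒱) {c : ℕ} {u : V}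
    (hu : u ∈ 𝒱 c) :
    gradedSpan 𝒱 β t ((N ⊔ Submodule.span A {u}).restrictScalars k) =
      gradedSpan 𝒱 β t (N.restrictScalars k) ⊔
      (⨆ i, (shiftPiece 𝒜 c (t i)).map (Algebra.lsmul k k A (β i))).map
        ((LinearMap.toSpanSingleton A V u).restrictScalars k) := by
  unfold gradedSpan
  rw [Submodule.map_iSup, ← iSup_sup_eq]
  refine iSup_congr fun i => ?_
  rw [inf_sup_span_singleton 𝒜 𝒱 hN hu, Submodule.map_sup, ← Submodule.map_comp,
    ← Submodule.map_comp]
  congr 2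
  ext a
  simp [Algebra.lsmul_coe]

lemma relRank_gradedSpan_sup_span_singleton {N : Submodule A V} (hN : N.IsHomogeneous 𝒱) {c : ℕ}
    {u : V} (hu : u ∈ 𝒱 c) :
    relRank (N.restrictScalars k)
      (gradedSpan 𝒱 β t ((N ⊔ Submodule.span A {u}).restrictScalars k)) =
    relRank ((annModulo N u).restrictScalars k)
      (⨆ i, (shiftPiece 𝒜 c (t i)).map (Algebra.lsmul k k A (β i))) := by
  rw [gradedSpan_sup_span_singleton 𝒜 𝒱 β t hN hu, relRank_sup_of_le,
    relRank_map_toSpanSingleton]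
  have h := gradedSpan_le (𝒱 := 𝒱) (β := fun i => algebraMap B A (β i)) (t := t) N
  refine le_trans (le_of_eq ?_) h
  unfold gradedSpan
  refine iSup_congr fun i => ?_
  congr 1
  ext v
  simp [Algebra.lsmul_coe]

end Algebra

end Cyclic

/-- `h` grows like the Hilbert function of a graded module of dimension at most `e`, in a form
which also makes sense for `e ≤ 1`. -/
def GrowthLE (h : ℕ → ℕ) (e : ℕ) : Prop :=
  ∃ C : ℕ, ∀ n, h n * (n + 1) ^ 2 ≤ C * (n + 1) ^ e ∧
    (∑ i ∈ Finset.range (n + 1), h i) * (n + 1) ≤ C * (n + 1) ^ e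

lemma GrowthLE.mono {h h' : ℕ → ℕ} {e : ℕ} (hh : GrowthLE h' e) (hle : ∀ n, h n ≤ h' n) :
    GrowthLE h e := by
  obtain ⟨C, hC⟩ := hh
  exact ⟨C, fun n => ⟨(Nat.mul_le_mul_right _ (hle n)).trans (hC n).1,
    (Nat.mul_le_mul_right _ (Finset.sum_le_sum fun i _ => hle i)).trans (hC n).2⟩⟩

lemma GrowthLE.add {h h' : ℕ → ℕ} {e : ℕ} (hh : GrowthLE h e) (hh' : GrowthLE h' e) :
    GrowthLE (fun n => h n + h' n) e := by
  obtain ⟨C, hC⟩ := hh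
  obtain ⟨C', hC'⟩ := hh'
  refine ⟨C + C', fun n => ⟨?_, ?_⟩⟩
  · rw [add_mul, add_mul]
    exact Nat.add_le_add (hC n).1 (hC' n).1
  · rw [Finset.sum_add_distrib, add_mul, add_mul]
    exact Nat.add_le_add (hC n).2 (hC' n).2

lemma GrowthLE.zero (e : ℕ) : GrowthLE (fun _ => 0) e := ⟨0, fun n => by simp⟩

lemma GrowthLE.shift {h : ℕ → ℕ} {e : ℕ} (hh : GrowthLE h e) (c : ℕ) :
    GrowthLE (fun n => if c ≤ n then h (n - c) else 0) e := by
  obtain ⟨C, hC⟩ := hh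
  refine ⟨(c + 1) ^ 2 * C, fun n => ⟨?_, ?_⟩⟩
  · dsimp only
    split_ifs with hn
    · obtain ⟨m, rfl⟩ := Nat.exists_eq_add_of_le hn
      rw [Nat.add_sub_cancel_left]
      have h1 : c + m + 1 ≤ (c + 1) * (m + 1) := by nlinarith
      calc h m * (c + m + 1) ^ 2 ≤ h m * ((c + 1) * (m + 1)) ^ 2 := by gcongr
        _ = (c + 1) ^ 2 * (h m * (m + 1) ^ 2) := by ring
        _ ≤ (c + 1) ^ 2 * (C * (m + 1) ^ e) :=
          Nat.mul_le_mul_left _ (hC m).1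
        _ ≤ (c + 1) ^ 2 * (C * (c + m + 1) ^ e) := by gcongr; lia
        _ = _ := by ring
    · simp
  · have h1 : (∑ i ∈ Finset.range (n + 1), if c ≤ i then h (i - c) else 0) ≤
        ∑ i ∈ Finset.range (n + 1), h i := by
      rw [← Finset.sum_filter]
      rw [← Finset.sum_image (f := h) (g := fun i => i - c)]
      · refine Finset.sum_le_sum_of_subset fun i hi => ?_
        simp only [Finset.mem_image, Finset.mem_filter, Finset.mem_range] at *
        lia
      · intro i hi j hj hij
        simp only [Finset.coe_filter, Set.mem_ofPred_eq] at *
        lia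
    calc _ ≤ (∑ i ∈ Finset.range (n + 1), h i) * (n + 1) := by gcongr
      _ ≤ C * (n + 1) ^ e := (hC n).2
      _ ≤ (c + 1) ^ 2 * C * (n + 1) ^ e := by
        gcongr
        exact Nat.le_mul_of_pos_left _ (by positivity)

/-- Integrating a growth bound. -/
lemma GrowthLE.succ_of_recurrence {h h' : ℕ → ℕ} {e g : ℕ} (hg : 0 < g) (hh' : GrowthLE h' e)
    (hrec : ∀ n, h n ≤ (if g ≤ n then h (n - g) else 0) + h' n) : GrowthLE h (e + 1) := by
  obtain ⟨C, hC⟩ := hh'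
  have key : ∀ n, h n ≤ ∑ i ∈ Finset.range (n + 1), h' i := by
    intro n
    induction n using Nat.strong_induction_on with
    | _ n ih =>
      refine (hrec n).trans ?_
      rw [Finset.sum_range_succ]
      gcongr
      split_ifs with hn
      · refine (ih (n - g) (by lia)).trans (Finset.sum_le_sum_of_subset ?_)
        intro i hi
        simp only [Finset.mem_range] at *
        lia
      · exact Nat.zero_le _
  have key' : ∀ n, h n * (n + 1) ≤ C * (n + 1) ^ e := fun n =>
    (Nat.mul_le_mul_right _ (key n)).trans (hC n).2
  refine ⟨C, fun n => ⟨?_, ?_⟩⟩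
  · calc h n * (n + 1) ^ 2 = h n * (n + 1) * (n + 1) := by ring
      _ ≤ C * (n + 1) ^ e * (n + 1) := Nat.mul_le_mul_right _ (key' n)
      _ = _ := by ring
  · have : (∑ i ∈ Finset.range (n + 1), h i) ≤
        (n + 1) * ∑ i ∈ Finset.range (n + 1), h' i := by
      calc (∑ i ∈ Finset.range (n + 1), h i) ≤
          ∑ _i ∈ Finset.range (n + 1), ∑ j ∈ Finset.range (n + 1), h' j := by
            refine Finset.sum_le_sum fun i hi => (key i).trans (Finset.sum_le_sum_of_subset ?_)
            intro j hj
            simp only [Finset.mem_range] at *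
            lia
        _ = _ := by simp
    calc _ ≤ ((n + 1) * ∑ i ∈ Finset.range (n + 1), h' i) * (n + 1) := by gcongr
      _ = (n + 1) * ((∑ i ∈ Finset.range (n + 1), h' i) * (n + 1)) := by ring
      _ ≤ (n + 1) * (C * (n + 1) ^ e) := Nat.mul_le_mul_left _ (hC n).2
      _ = _ := by ring

lemma GrowthLE.le {h : ℕ → ℕ} {e : ℕ} (hh : GrowthLE h e) (he : 2 ≤ e) :
    ∃ C, ∀ n, h n ≤ C * (n + 1) ^ (e - 2) := by
  obtain ⟨C, hC⟩ := hh
  refine ⟨C, fun n => ?_⟩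
  have := (hC n).1
  obtain ⟨f, rfl⟩ := Nat.exists_eq_add_of_le' he
  rw [pow_add, ← mul_assoc] at this
  exact Nat.le_of_mul_le_mul_right this (by positivity)

section Growth

open DirectSum Module

variable {k A : Type*} [Field k] [CommRing A] [Algebra k A]
  (𝒜 : ℕ → Submodule k A)

lemma relRank_shiftPiece (𝔞 : Ideal A) (c n : ℕ) :
    relRank (𝔞.restrictScalars k) (shiftPiece 𝒜 c n) =
      if c ≤ n then relRank (𝔞.restrictScalars k) (𝒜 (n - c)) else 0 := by
  unfold shiftPiece
  split_ifs
  · rfl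
  · exact relRank_eq_zero bot_le

lemma ringKrullDim_quotient_lt_of_lt {P Q : Ideal A} [P.IsPrime] (h : P < Q) (e : ℕ)
    (hP : ringKrullDim (A ⧸ P) < (e + 1 : ℕ)) : ringKrullDim (A ⧸ Q) < e := by
  obtain ⟨hle, x, hxQ, hxP⟩ := SetLike.lt_iff_le_and_exists.mp h
  have := ringKrullDim_succ_le_of_surjective (Ideal.Quotient.factor hle)
    (Ideal.Quotient.factor_surjective hle) (r := Ideal.Quotient.mk P x)
    (mem_nonZeroDivisors_of_ne_zero (by rwa [Ne, Ideal.Quotient.eq_zero_iff_mem]))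
    (by rw [Ideal.Quotient.factor_mk]; exact Ideal.Quotient.eq_zero_iff_mem.mpr hxQ)
  by_contra! hc
  refine absurd (this.trans_lt hP) (not_lt.mpr ?_)
  push_cast
  gcongr

variable [IsNoetherianRing A] [GradedAlgebra 𝒜] [∀ n, FiniteDimensional k (𝒜 n)]

lemma growthLE_of_forall_prime {𝔞 : Ideal A} (h𝔞 : 𝔞.IsHomogeneous 𝒜) {e : ℕ}
    (h : ∀ P : Ideal A, P.IsPrime → P.IsHomogeneous 𝒜 → 𝔞 ≤ P →
      GrowthLE (fun n => relRank (P.restrictScalars k) (𝒜 n)) e) :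
    GrowthLE (fun n => relRank (𝔞.restrictScalars k) (𝒜 n)) e := by
  have := graded_devissage 𝒜 𝒜 (N₁ := 𝔞) (N := ⊤) h𝔞
    (fun _ _ _ => Submodule.mem_top) le_top
    (fun N => GrowthLE (fun n => relRank (𝔞.restrictScalars k) (𝒜 n ⊓ N.restrictScalars k)) e)
    ((GrowthLE.zero e).mono fun n => (relRank_eq_zero inf_le_right).le) ?_
  · refine this.mono fun n => ?_
    rw [Submodule.restrictScalars_top, inf_top_eq]
  · intro N c u hN _ hhom hu hp hph ih
    refine (((h _ hp hph ?_).shift c).add ih).mono fun n => ?_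
    · intro a ha
      rw [mem_annModulo]
      exact hN (by rw [smul_eq_mul]; exact 𝔞.mul_mem_right _ ha)
    · rw [← relRank_shiftPiece, ← relRank_inf_sup_span_singleton 𝒜 𝒜 hhom hu]
      refine (relRank_le_add _ (N.restrictScalars k) _).trans (Nat.add_le_add_left ?_ _)
      exact relRank_mono (le_inf (inf_le_left.trans inf_le_left) inf_le_right)

theorem growthLE_of_isPrime (e : ℕ) : ∀ P : Ideal A, P.IsPrime → P.IsHomogeneous 𝒜 →
    ringKrullDim (A ⧸ P) < e → GrowthLE (fun n => relRank (P.restrictScalars k) (𝒜 n)) e := by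
  induction e with
  | zero =>
    intro P hP _ hd
    exact absurd hd (not_lt.mpr (ringKrullDim_nonneg_of_nontrivial))
  | succ e ih =>
    intro P hP hPh hd
    by_cases hx : ∀ n, 0 < n → 𝒜 n ≤ P.restrictScalars k
    · have h0 : ∀ n, 0 < n → relRank (P.restrictScalars k) (𝒜 n) = 0 :=
        fun n hn => relRank_eq_zero (hx n hn)
      refine ⟨relRank (P.restrictScalars k) (𝒜 0), fun n => ⟨?_, ?_⟩⟩
      · rcases Nat.eq_zero_or_pos n with rfl | hn
        · simp
        · simp only [h0 n hn, zero_mul]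
          exact Nat.zero_le _
      · rw [Finset.sum_range_succ', Finset.sum_eq_zero fun i _ => h0 (i + 1) (by lia), zero_add]
        gcongr
        exact Nat.le_self_pow (by lia) _
    · push Not at hx
      obtain ⟨g, hg, hx⟩ := hx
      obtain ⟨x, hxg, hxP⟩ := Set.not_subset.mp hx
      have hxP : x ∉ P := hxP
      have hsup : (P ⊔ Ideal.span {x}).IsHomogeneous 𝒜 :=
        isHomogeneous_sup 𝒜 hPh (isHomogeneous_span_singleton 𝒜 𝒜 hxg)
      have hann : annModulo P x = P := by
        ext a
        rw [mem_annModulo, smul_eq_mul]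
        exact ⟨fun h => (hP.mem_or_mem h).resolve_right hxP, fun h => P.mul_mem_right _ h⟩
      refine GrowthLE.succ_of_recurrence hg (growthLE_of_forall_prime 𝒜 hsup (e := e) ?_) ?_
      · intro Q hQ hQh hle
        refine ih Q hQ hQh (ringKrullDim_quotient_lt_of_lt (P := P) ?_ e hd)
        refine lt_of_le_of_ne (le_sup_left.trans hle) ?_
        rintro rfl
        exact hxP (hle (Ideal.mem_sup_right (Ideal.mem_span_singleton_self x)))
      · intro n
        have h1 := relRank_inf_sup_span_singleton 𝒜 𝒜 hPh hxg n
        rw [hann, relRank_shiftPiece] at h1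
        rw [← h1, add_comm]
        exact relRank_le_add _ _ _

theorem growthLE_of_forall_lt {𝔞 : Ideal A} (h𝔞 : 𝔞.IsHomogeneous 𝒜) {d : ℕ}
    (h : ∀ P : Ideal A, P.IsPrime → P.IsHomogeneous 𝒜 → 𝔞 ≤ P → ringKrullDim (A ⧸ P) < d) :
    GrowthLE (fun n => relRank (𝔞.restrictScalars k) (𝒜 n)) d :=
  growthLE_of_forall_prime 𝒜 h𝔞 fun P hP hPh hle =>
    growthLE_of_isPrime 𝒜 d P hP hPh (h P hP hPh hle)

end Growth

section UpperBound

open DirectSum Module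

variable {k A V : Type*} [Field k] [CommRing A] [Algebra k A]
  [AddCommGroup V] [Module A V] [Module k V] [IsScalarTower k A V]
  (𝒜 : ℕ → Submodule k A) [GradedAlgebra 𝒜]
  (𝒱 : ℕ → Submodule k V) [Decomposition 𝒱] [SetLike.GradedSMul 𝒜 𝒱]

lemma mem_minimalPrimes_of_not_lt {d : ℕ} (hd : ringKrullDim A ≤ d) {P : Ideal A} (hP : P.IsPrime)
    (h : ¬ ringKrullDim (A ⧸ P) < d) : P ∈ minimalPrimes A := by
  obtain ⟨Q, hQ, hle⟩ := Ideal.exists_minimalPrimes_le (I := (⊥ : Ideal A)) (J := P) bot_le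
  have hQp : Q.IsPrime := hQ.1.1
  rcases eq_or_lt_of_le hle with rfl | hlt
  · exact hQ
  · refine absurd (ringKrullDim_quotient_lt_of_lt hlt d ?_) h
    refine ((ringKrullDim_quotient_le Q).trans hd).trans_lt ?_
    exact_mod_cast Nat.lt_succ_self d

lemma exists_mul_eq_zero_of_mem_minimalPrimes [IsNoetherianRing A] [IsReduced A] {P : Ideal A}
    (hP : P ∈ minimalPrimes A) (hh : P.IsHomogeneous 𝒜) :
    ∃ g, ∃ s ∈ 𝒜 g, s ∉ P ∧ ∀ a ∈ P, a * s = 0 := by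
  classical
  have hPp : P.IsPrime := hP.1.1
  have hfin : (minimalPrimes A).Finite := minimalPrimes.finite_of_isNoetherianRing A
  let S : Finset (Ideal A) := hfin.toFinset.erase P
  have hS : ¬ S.inf id ≤ P := by
    intro hle
    obtain ⟨Q, hQ, hQP⟩ := (hPp.inf_le').mp hle
    rw [Finset.mem_erase, Set.Finite.mem_toFinset] at hQ
    exact hQ.1 (le_antisymm hQP (hP.2 hQ.2.1 hQP))
  obtain ⟨s', hs', hs'P⟩ := Set.not_subset.mp hS
  have hz : ∀ a ∈ P, a * s' = 0 := by
    intro a ha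
    have : a * s' ∈ sInf (minimalPrimes A) := by
      rw [Submodule.mem_sInf]
      intro Q hQ
      by_cases hQP : Q = P
      · rw [hQP]; exact P.mul_mem_right _ ha
      · refine Ideal.mul_mem_left Q _ ?_
        have : S.inf id ≤ Q := Finset.inf_le (f := id)
          (Finset.mem_erase.mpr ⟨hQP, hfin.mem_toFinset.mpr hQ⟩)
        exact this hs'
    have h0 : sInf (minimalPrimes A) = (⊥ : Ideal A) := by
      have := Ideal.sInf_minimalPrimes (I := (⊥ : Ideal A))
      rw [minimalPrimes, this]
      exact nilradical_eq_zero A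
    rw [h0] at this
    exact this
  have : ∃ n, gradedProj 𝒜 n s' ∉ P := by
    by_contra! hc
    exact hs'P ((Ideal.IsHomogeneous.mem_iff 𝒜 hh).mpr hc)
  obtain ⟨g, hg⟩ := this
  refine ⟨g, _, gradedProj_mem 𝒜 g s', hg, fun a ha => ?_⟩
  obtain ⟨T, hT, -⟩ := exists_sum_gradedProj 𝒜 a
  rw [hT, Finset.sum_mul]
  refine Finset.sum_eq_zero fun j _ => ?_
  have h1 := hz _ (hh j ha)
  have h2 := gradedProj_smul_of_le 𝒜 𝒜 (gradedProj_mem 𝒜 j a) (Nat.le_add_right j g) s'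
  rw [Nat.add_sub_cancel_left, smul_eq_mul, smul_eq_mul] at h2
  rw [← h2]
  exact (congrArg _ h1).trans (map_zero _)

lemma sum_le_of_growth {h : ℕ → ℕ} {e C : ℕ} (hC : ∀ n, h n ≤ C * (n + 1) ^ e) {ι : Type*}
    [Fintype ι] {t : ι → ℕ} {T : ℕ} (hT : ∀ i, t i ≤ T) :
    ∑ i, h (t i) ≤ C * Fintype.card ι * (T + 1) ^ e := by
  calc ∑ i, h (t i) ≤ ∑ _i : ι, C * (T + 1) ^ e := by
        refine Finset.sum_le_sum fun i _ => (hC _).trans ?_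
        gcongr
        exact hT i
    _ = _ := by rw [Finset.sum_const, Finset.card_univ, smul_eq_mul]; ring

theorem relRank_gradedSpan_le_add [IsNoetherianRing A] [IsReduced A]
    [∀ n, FiniteDimensional k (𝒜 n)] [∀ n, FiniteDimensional k (𝒱 n)] [Module.Finite A V]
    {d : ℕ} (h2 : 2 ≤ d) (hd : ringKrullDim A ≤ d)
    {N₁ N : Submodule A V} (h₁ : N₁.IsHomogeneous 𝒱) (hN : N.IsHomogeneous 𝒱) (hle : N₁ ≤ N) :
    ∃ C : ℕ, ∀ (ι : Type) [Fintype ι] (β : ι → A) (t : ι → ℕ) (T : ℕ), (∀ i, t i ≤ T) →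
      relRank ⊥ (gradedSpan 𝒱 β t (N.restrictScalars k)) ≤
        relRank ⊥ (gradedSpan 𝒱 β t (N₁.restrictScalars k)) +
        relRank (N₁.restrictScalars k) (gradedSpan 𝒱 β t (N.restrictScalars k)) +
        C * Fintype.card ι * (T + 1) ^ (d - 2) := by
  refine graded_devissage 𝒜 𝒱 h₁ hN hle (fun N => ∃ C : ℕ, ∀ (ι : Type) [Fintype ι] (β : ι → A)
    (t : ι → ℕ) (T : ℕ), (∀ i, t i ≤ T) →
      relRank ⊥ (gradedSpan 𝒱 β t (N.restrictScalars k)) ≤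
        relRank ⊥ (gradedSpan 𝒱 β t (N₁.restrictScalars k)) +
        relRank (N₁.restrictScalars k) (gradedSpan 𝒱 β t (N.restrictScalars k)) +
        C * Fintype.card ι * (T + 1) ^ (d - 2)) ?_ ?_
  · exact ⟨0, fun ι _ β t T _ => by lia⟩
  · rintro N' c u hN' - hhom hu hp hph ⟨C, hC⟩
    by_cases hdim : ringKrullDim (A ⧸ annModulo N' u) < d
    · obtain ⟨C', hC'⟩ := ((growthLE_of_isPrime 𝒜 d _ hp hph hdim).shift c).le h2
      refine ⟨C + C', fun ι _ β t T hT => ?_⟩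
      have e1 := relRank_gradedSpan_le (𝒱 := 𝒱) (β := β) (t := t)
        ((N' ⊔ Submodule.span A {u}).restrictScalars k) (N'.restrictScalars k) ⊥
      have e2 := sum_le_of_growth hC' hT
      simp only [← relRank_shiftPiece, ← relRank_inf_sup_span_singleton 𝒜 𝒱 hhom hu] at e2
      have e3 := hC ι β t T hT
      have e4 : relRank (N₁.restrictScalars k) (gradedSpan 𝒱 β t (N'.restrictScalars k)) ≤
          relRank (N₁.restrictScalars k)
            (gradedSpan 𝒱 β t ((N' ⊔ Submodule.span A {u}).restrictScalars k)) :=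
        relRank_mono (gradedSpan_mono fun x hx => Submodule.mem_sup_left hx)
      rw [add_mul, add_mul]
      lia
    · obtain ⟨g, s, hsg, hsp, hs⟩ := exists_mul_eq_zero_of_mem_minimalPrimes 𝒜
        (mem_minimalPrimes_of_not_lt hd hp hdim) hph
      have hsum : (annModulo N' u ⊔ Ideal.span {s}).IsHomogeneous 𝒜 :=
        isHomogeneous_sup 𝒜 hph (isHomogeneous_span_singleton 𝒜 𝒜 hsg)
      obtain ⟨C', hC'⟩ := ((growthLE_of_forall_lt 𝒜 hsum (d := d) (by
        intro Q hQ _ hQle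
        refine ringKrullDim_quotient_lt_of_lt (P := annModulo N' u)
          (lt_of_le_of_ne (le_sup_left.trans hQle) ?_) d ?_
        · intro he
          refine hsp ?_
          rw [he]
          exact hQle (Ideal.mem_sup_right (Ideal.mem_span_singleton_self s))
        · refine ((ringKrullDim_quotient_le _).trans hd).trans_lt ?_
          exact_mod_cast Nat.lt_succ_self d)).shift c).le h2
      have hsu : s • u ∈ 𝒱 (g + c) := gradedSMul_mem 𝒜 𝒱 hsg hu
      have hle1 : N' ⊔ Submodule.span A {s • u} ≤ N' ⊔ Submodule.span A {u} := by
        refine sup_le_sup_left ?_ _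
        rw [Submodule.span_singleton_le_iff_mem]
        exact Submodule.smul_mem _ _ (Submodule.mem_span_singleton_self u)
      have hhom' : (N' ⊔ Submodule.span A {s • u}).IsHomogeneous 𝒱 :=
        isHomogeneous_sup 𝒱 hhom (isHomogeneous_span_singleton 𝒜 𝒱 hsu)
      have hNN : N' ⊔ Submodule.span A {s • u} ⊔ Submodule.span A {u} =
          N' ⊔ Submodule.span A {u} := by
        refine le_antisymm (sup_le hle1 le_sup_right) (sup_le_sup_right le_sup_left _)
      have hann : annModulo ⊥ (s • u) = annModulo N' (s • u) := by
        ext a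
        rw [mem_annModulo, mem_annModulo]
        constructor
        · intro h
          rw [(Submodule.mem_bot A).mp h]
          exact zero_mem _
        · intro h
          rw [smul_smul] at h
          have ha : a ∈ annModulo N' u := (hp.mem_or_mem (mem_annModulo.mpr h)).resolve_right hsp
          rw [smul_smul, hs a ha, zero_smul]
          exact zero_mem _
      refine ⟨C + C', fun ι _ β t T hT => ?_⟩
      have e1 := relRank_gradedSpan_le (𝒱 := 𝒱) (β := β) (t := t)
        ((N' ⊔ Submodule.span A {u}).restrictScalars k)
        ((N' ⊔ Submodule.span A {s • u}).restrictScalars k) ⊥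
      have e2 : ∑ i, relRank ((N' ⊔ Submodule.span A {s • u}).restrictScalars k)
          (𝒱 (t i) ⊓ (N' ⊔ Submodule.span A {u}).restrictScalars k) ≤
          C' * Fintype.card ι * (T + 1) ^ (d - 2) := by
        refine le_trans (Finset.sum_le_sum fun i _ => ?_) (sum_le_of_growth hC' hT)
        rw [← relRank_shiftPiece, ← hNN, relRank_inf_sup_span_singleton 𝒜 𝒱 hhom' hu]
        refine relRank_anti ?_
        rw [Submodule.restrictScalars_le]
        refine sup_le (fun a ha => Submodule.mem_sup_left ha) ?_
        rw [Ideal.span_singleton_le_iff_mem, mem_annModulo]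
        exact Submodule.mem_sup_right (Submodule.mem_span_singleton_self _)
      have e3 := hC ι β t T hT
      have e4 : relRank ⊥ (gradedSpan 𝒱 β t
          ((N' ⊔ Submodule.span A {s • u}).restrictScalars k)) ≤
          relRank ⊥ (gradedSpan 𝒱 β t (N'.restrictScalars k)) +
          relRank (N'.restrictScalars k) (gradedSpan 𝒱 β t
          ((N' ⊔ Submodule.span A {s • u}).restrictScalars k)) := by
        rw [relRank_gradedSpan_sup_span_singleton 𝒜 𝒱 β t hhom hsu,
          gradedSpan_sup_span_singleton 𝒜 𝒱 β t hhom hsu]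
        refine (relRank_sup_le _ _ _).trans (Nat.add_le_add_left ?_ _)
        rw [← hann, ← relRank_map_toSpanSingleton, Submodule.restrictScalars_bot]
      have e5 : relRank (N'.restrictScalars k) (gradedSpan 𝒱 β t
          ((N' ⊔ Submodule.span A {s • u}).restrictScalars k)) ≤
          relRank (N'.restrictScalars k)
            (gradedSpan 𝒱 β t ((N' ⊔ Submodule.span A {u}).restrictScalars k)) :=
        relRank_mono (gradedSpan_mono hle1)
      have e6 := relRank_gradedSpan_superadd (𝒱 := 𝒱) (β := β) (t := t)
        (N₀ := N₁.restrictScalars k) (N' := N')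
        (N := (N' ⊔ Submodule.span A {u}).restrictScalars k) hN'
        (fun x hx => Submodule.mem_sup_left hx)
      rw [add_mul, add_mul]
      lia

end UpperBound

section HomogeneousSubalgebra

open DirectSum Module

variable {k R : Type*} [Field k] [CommRing R] [Algebra k R]
  (𝒜 : ℕ → Submodule k R) (A : Subalgebra k R)

/-- The trace on a subalgebra of a grading. -/
def subalgebraGrading (n : ℕ) : Submodule k A := (𝒜 n).comap A.val.toLinearMap

instance [∀ n, FiniteDimensional k (𝒜 n)] (n : ℕ) :
    FiniteDimensional k (subalgebraGrading 𝒜 A n) := by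
  let f : subalgebraGrading 𝒜 A n →ₗ[k] 𝒜 n :=
    (A.val.toLinearMap ∘ₗ (subalgebraGrading 𝒜 A n).subtype).codRestrict (𝒜 n) fun x => x.2
  refine FiniteDimensional.of_injective f fun x y h => ?_
  have : ((x : A) : R) = ((y : A) : R) := by
      have h' := congrArg (𝒜 n).subtype h
      exact h'
  exact Subtype.ext (Subtype.ext this)

instance {M : Type*} [AddCommGroup M] [Module R M] [Module k M] [IsScalarTower k R M]
    (ℳ : ℕ → Submodule k M) [SetLike.GradedSMul 𝒜 ℳ] :
    SetLike.GradedSMul (subalgebraGrading 𝒜 A) ℳ where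
  smul_mem {i j a m} ha hm := by
    have : (a : R) • m ∈ ℳ (i +ᵥ j) := SetLike.GradedSMul.smul_mem (A := 𝒜) ha hm
    exact this

/-- A subalgebra closed under taking homogeneous components is graded. -/
lemma nonempty_gradedAlgebra_subalgebraGrading [GradedAlgebra 𝒜]
    (h : ∀ a ∈ A, ∀ n, gradedProj 𝒜 n a ∈ A) :
    Nonempty (GradedAlgebra (subalgebraGrading 𝒜 A)) := by
  classical
  have hm : SetLike.GradedMonoid (subalgebraGrading 𝒜 A) :=
    { one_mem := SetLike.GradedOne.one_mem (A := 𝒜)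
      mul_mem := fun {i j a b} ha hb => SetLike.GradedMul.mul_mem (A := 𝒜) ha hb }
  have hi : DirectSum.IsInternal (subalgebraGrading 𝒜 A) := by
    refine DirectSum.isInternal_submodule_of_iSupIndep_of_iSup_eq_top ?_ ?_
    · intro i
      rw [Submodule.disjoint_def]
      intro x hx hx'
      have h1 : (⨆ j, ⨆ (_ : j ≠ i), subalgebraGrading 𝒜 A j) ≤
          LinearMap.ker (gradedProj 𝒜 i ∘ₗ A.val.toLinearMap) :=
        iSup₂_le fun j hj y hy => gradedProj_of_mem_ne 𝒜 hy hj
      have h2 : gradedProj 𝒜 i (x : R) = 0 := h1 hx'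
      exact Subtype.ext ((gradedProj_of_mem 𝒜 hx).symm.trans h2)
    · rw [eq_top_iff]
      intro x _
      obtain ⟨s, hs, -⟩ := exists_sum_gradedProj 𝒜 (x : R)
      have : x = ∑ n ∈ s, ⟨gradedProj 𝒜 n (x : R), h x x.2 n⟩ := by
        apply Subtype.ext
        rw [AddSubmonoidClass.coe_finsetSum]
        exact hs
      rw [this]
      refine Submodule.sum_mem _ fun n _ => ?_
      exact Submodule.mem_iSup_of_mem n (gradedProj_mem 𝒜 n (x : R))
  exact ⟨{ hm with toDecomposition := hi.chooseDecomposition }⟩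

end HomogeneousSubalgebra

section FrobeniusSubalgebra

open DirectSum Module

variable (k : Type*) [Field k] (p : ℕ) [ExpChar k p] [PerfectRing k p]
  {R : Type*} [CommRing R] [Algebra k R] [ExpChar R p]

/-- The subalgebra of `p ^ e`-th powers. -/
def powSubalgebra (R : Type*) [CommRing R] [Algebra k R] [ExpChar R p] (e : ℕ) :
    Subalgebra k R where
  __ := (iterateFrobenius R p e).range
  algebraMap_mem' c := by
    obtain ⟨b, rfl⟩ := (iterateFrobeniusEquiv k p e).surjective c
    refine ⟨algebraMap k R b, ?_⟩
    rw [iterateFrobenius_def, iterateFrobeniusEquiv_def, map_pow]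

/-- The map `r ↦ r ^ (p ^ e)`. -/
def toPowSubalgebra (R : Type*) [CommRing R] [Algebra k R] [ExpChar R p] (e : ℕ) :
    R →+* powSubalgebra k p R e :=
  (iterateFrobenius R p e).codRestrict (powSubalgebra k p R e) fun r => ⟨r, rfl⟩

lemma toPowSubalgebra_surjective (e : ℕ) : Function.Surjective (toPowSubalgebra k p R e) := by
  rintro ⟨_, r, rfl⟩
  exact ⟨r, rfl⟩

lemma gradedProj_mem_powSubalgebra (𝒜 : ℕ → Submodule k R) [GradedAlgebra 𝒜] (e : ℕ) :
    ∀ a ∈ powSubalgebra k p R e, ∀ n, gradedProj 𝒜 n a ∈ powSubalgebra k p R e := by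
  rintro _ ⟨r, rfl⟩ n
  refine graded_induction 𝒜 (motive := fun r => gradedProj 𝒜 n (iterateFrobenius R p e r) ∈
    powSubalgebra k p R e) r (by simp) (fun x y hx hy => ?_) fun m x hx => ?_
  · rw [map_add, map_add]
    exact add_mem hx hy
  · have : iterateFrobenius R p e x ∈ 𝒜 (p ^ e • m) := SetLike.pow_mem_graded _ hx
    by_cases h : p ^ e • m = n
    · subst h
      rw [gradedProj_of_mem 𝒜 this]
      exact ⟨x, rfl⟩
    · rw [gradedProj_of_mem_ne 𝒜 this h]
      exact zero_mem _

lemma finite_powSubalgebra [Algebra.FiniteType k R] (hp : 0 < p) (e : ℕ) :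
    Module.Finite (powSubalgebra k p R e) R := by
  have h1 : Algebra.FiniteType (powSubalgebra k p R e) R :=
    Algebra.FiniteType.of_restrictScalars_finiteType k _ _
  have h2 : Algebra.IsIntegral (powSubalgebra k p R e) R := by
    refine ⟨fun r => ?_⟩
    refine IsIntegral.of_pow (n := p ^ e) (by positivity) ?_
    exact isIntegral_algebraMap (x := (⟨r ^ p ^ e, r, rfl⟩ : powSubalgebra k p R e))
  exact Algebra.finite_iff_isIntegral_and_finiteType.mpr ⟨h2, h1⟩

lemma exists_isReduced_powSubalgebra [IsNoetherianRing R] (hp : 1 < p) :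
    ∃ e, IsReduced (powSubalgebra k p R e) := by
  obtain ⟨N, hN⟩ := IsNoetherianRing.isNilpotent_nilradical R
  refine ⟨N, ⟨?_⟩⟩
  rintro ⟨_, r, rfl⟩ ⟨m, hm⟩
  have hr : IsNilpotent r := by
    refine ⟨p ^ N * m, ?_⟩
    rw [pow_mul]
    exact congrArg Subtype.val hm
  have h1 : r ^ N = 0 := by
    have := Ideal.pow_mem_pow (mem_nilradical.mpr hr) N
    rwa [hN] at this
  apply Subtype.ext
  exact pow_eq_zero_of_le (Nat.lt_pow_self hp).le h1

end FrobeniusSubalgebra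

section LocalLength

variable {R : Type*} [CommRing R]

lemma length_localizedModule_of_cyclic {X : Type*} [AddCommGroup X] [Module R X] (P : Ideal R)
    [P.IsPrime] (x : X) (hx : ∀ y : X, ∃ r : R, y = r • x) (hann : ∀ r : R, r • x = 0 ↔ r ∈ P) :
    Module.length (Localization P.primeCompl) (LocalizedModule P.primeCompl X) = 1 := by
  rw [Module.length_eq_one_iff, isSimpleModule_iff_toSpanSingleton_surjective]
  have hmk : ∀ (r : R) (s : P.primeCompl), LocalizedModule.mk (r • x) s = 0 ↔ r ∈ P := by
    intro r s
    rw [← LocalizedModule.zero_mk (1 : P.primeCompl), LocalizedModule.mk_eq]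
    constructor
    · rintro ⟨u, hu⟩
      simp only [one_smul, smul_zero] at hu
      rw [Submonoid.smul_def, smul_smul, hann] at hu
      exact (Ideal.IsPrime.mem_or_mem ‹_› hu).resolve_left u.2
    · intro hr
      exact ⟨1, by rw [(hann r).mpr hr]; simp⟩
  constructor
  · refine ⟨LocalizedModule.mk ((1 : R) • x) 1, 0, fun h => ?_⟩
    rw [hmk] at h
    exact (Ideal.ne_top_iff_one P).mp (Ideal.IsPrime.ne_top ‹_›) h
  · intro y hy z
    induction y using LocalizedModule.induction_on with | _ y s
    induction z using LocalizedModule.induction_on with | _ z t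
    obtain ⟨r, rfl⟩ := hx y
    obtain ⟨a, rfl⟩ := hx z
    rw [Ne, hmk] at hy
    refine ⟨Localization.mk (a * s) (⟨r, hy⟩ * t), ?_⟩
    rw [LinearMap.toSpanSingleton_apply, LocalizedModule.mk_smul_mk, LocalizedModule.mk_eq]
    refine ⟨1, ?_⟩
    simp only [one_smul, Submonoid.smul_def, smul_smul, Submonoid.coe_mul]
    congr 1
    ring

lemma length_localizedModule_of_smul {X : Type*} [AddCommGroup X] [Module R X] (P : Ideal R)
    [P.IsPrime] (s : R) (hs : s ∉ P) (hX : ∀ y : X, s • y = 0) :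
    Module.length (Localization P.primeCompl) (LocalizedModule P.primeCompl X) = 0 := by
  rw [Module.length_eq_zero_iff]
  refine subsingleton_of_forall_eq 0 fun y => ?_
  induction y using LocalizedModule.induction_on with | _ y t
  rw [← LocalizedModule.zero_mk (1 : P.primeCompl), LocalizedModule.mk_eq]
  refine ⟨⟨s, hs⟩, ?_⟩
  simp only [one_smul, smul_zero, Submonoid.smul_def]
  exact hX y

/-- The length of the localization at `P` of a submodule. -/
noncomputable def localLength {M : Type*} [AddCommGroup M] [Module R M] (P : Ideal R) [P.IsPrime]
    (N : Submodule R M) : ℕ∞ :=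
  Module.length (Localization P.primeCompl) (LocalizedModule P.primeCompl N)

variable {M : Type*} [AddCommGroup M] [Module R M] (P : Ideal R) [P.IsPrime]

lemma length_localizedModule_eq_add {N N' : Type*} [AddCommGroup N] [Module R N] [AddCommGroup N']
    [Module R N'] (f : N' →ₗ[R] N) (hf : Function.Injective f) :
    Module.length (Localization P.primeCompl) (LocalizedModule P.primeCompl N) =
      Module.length (Localization P.primeCompl) (LocalizedModule P.primeCompl N') +
      Module.length (Localization P.primeCompl)
        (LocalizedModule P.primeCompl (N ⧸ LinearMap.range f)) :=
  Module.length_eq_add_of_exact (LocalizedModule.map P.primeCompl f)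
    (LocalizedModule.map P.primeCompl (LinearMap.range f).mkQ)
    (LocalizedModule.map_injective _ _ hf)
    (LocalizedModule.map_surjective _ _ (Submodule.mkQ_surjective _))
    (LocalizedModule.map_exact _ _ _ (LinearMap.exact_map_mkQ_range f))

lemma localLength_bot : localLength P (⊥ : Submodule R M) = 0 :=
  length_localizedModule_of_smul P 1 ((Ideal.ne_top_iff_one P).mp (Ideal.IsPrime.ne_top ‹_›))
    fun _ => Subsingleton.elim _ _

lemma localLength_top : localLength P (⊤ : Submodule R M) =
    Module.length (Localization P.primeCompl) (LocalizedModule P.primeCompl M) := by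
  rw [length_localizedModule_eq_add P (⊤ : Submodule R M).subtype
    (Submodule.injective_subtype _), length_localizedModule_of_smul
    (X := M ⧸ LinearMap.range (⊤ : Submodule R M).subtype) P 1
    ((Ideal.ne_top_iff_one P).mp (Ideal.IsPrime.ne_top ‹_›)) ?_, add_zero]
  · rfl
  · intro y
    obtain ⟨y, rfl⟩ := Submodule.mkQ_surjective _ y
    rw [one_smul, Submodule.mkQ_apply, Submodule.Quotient.mk_eq_zero]
    exact ⟨⟨y, trivial⟩, rfl⟩

lemma exists_generator_quotient_inclusion (N : Submodule R M) (u : M) :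
    ∃ x : (N ⊔ Submodule.span R {u} : Submodule R M) ⧸
        LinearMap.range (Submodule.inclusion (le_sup_left : N ≤ N ⊔ Submodule.span R {u})),
      (∀ y, ∃ r : R, y = r • x) ∧ ∀ r : R, r • x = 0 ↔ r • u ∈ N := by
  refine ⟨Submodule.Quotient.mk
    ⟨u, Submodule.mem_sup_right (Submodule.mem_span_singleton_self u)⟩, fun y => ?_, fun r => ?_⟩
  · obtain ⟨⟨y, hy⟩, rfl⟩ := Submodule.mkQ_surjective _ y
    obtain ⟨a, ha, b, hb, rfl⟩ := Submodule.mem_sup.mp hy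
    obtain ⟨r, rfl⟩ := Submodule.mem_span_singleton.mp hb
    refine ⟨r, ?_⟩
    rw [Submodule.mkQ_apply, ← Submodule.Quotient.mk_smul, Submodule.Quotient.eq]
    exact ⟨⟨a, ha⟩, Subtype.ext (by simp)⟩
  · rw [← Submodule.Quotient.mk_smul, Submodule.Quotient.mk_eq_zero]
    constructor
    · rintro ⟨⟨a, ha⟩, h⟩
      have h' : a = r • u := congrArg Subtype.val h
      rwa [← h']
    · intro h
      exact ⟨⟨r • u, h⟩, rfl⟩

lemma localLength_sup_span_singleton_self {N : Submodule R M} {u : M}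
    (h : ∀ r : R, r • u ∈ N ↔ r ∈ P) :
    localLength P (N ⊔ Submodule.span R {u}) = localLength P N + 1 := by
  obtain ⟨x, hx, hx'⟩ := exists_generator_quotient_inclusion N u
  unfold localLength
  rw [length_localizedModule_eq_add P (Submodule.inclusion le_sup_left)
    (Submodule.inclusion_injective _),
    length_localizedModule_of_cyclic P x hx fun r => (hx' r).trans (h r)]

lemma localLength_sup_span_singleton_of_notMem {N : Submodule R M} {u : M} {s : R}
    (hs : s ∉ P) (h : s • u ∈ N) :
    localLength P (N ⊔ Submodule.span R {u}) = localLength P N := by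
  obtain ⟨x, hx, hx'⟩ := exists_generator_quotient_inclusion N u
  unfold localLength
  rw [length_localizedModule_eq_add P (Submodule.inclusion le_sup_left)
    (Submodule.inclusion_injective _), length_localizedModule_of_smul
    (X := (N ⊔ Submodule.span R {u} : Submodule R M) ⧸
      LinearMap.range (Submodule.inclusion (le_sup_left : N ≤ N ⊔ Submodule.span R {u})))
    P s hs, add_zero]
  intro y
  obtain ⟨r, rfl⟩ := hx y
  rw [smul_comm, (hx' s).mpr h, smul_zero]

end LocalLength

section Additivity

open DirectSum Module

variable {k R M : Type*} [Field k] [CommRing R] [Algebra k R]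
  (𝒜 : ℕ → Submodule k R) [GradedAlgebra 𝒜]

lemma exists_mem_one_notMem [∀ m, FiniteDimensional k (𝒜 m)]
    (hstd : ∀ m : ℕ, (𝒜 (m + 1) : Set R) ⊆
      Submodule.span k (Set.image2 (· * ·) (𝒜 1 : Set R) (𝒜 m : Set R)))
    (Q : Ideal R) (hQ : 0 < ringKrullDim (R ⧸ Q)) : ∃ x ∈ 𝒜 1, x ∉ Q := by
  by_contra! hc
  have hm : ∀ m, 𝒜 (m + 1) ≤ Q.restrictScalars k := by
    intro m
    refine le_trans (hstd m) (Submodule.span_le.mpr ?_)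
    rintro _ ⟨x, hx, y, -, rfl⟩
    exact Q.mul_mem_right _ (hc x hx)
  have hfin : Module.Finite k (R ⧸ Q) := by
    refine Module.Finite.of_surjective
      ((Ideal.Quotient.mkₐ k Q).toLinearMap ∘ₗ (𝒜 0).subtype) fun y => ?_
    obtain ⟨y, rfl⟩ := Ideal.Quotient.mk_surjective y
    refine graded_induction 𝒜 (motive := fun y => ∃ a : 𝒜 0, ((Ideal.Quotient.mkₐ k Q).toLinearMap ∘ₗ
      (𝒜 0).subtype) a = Ideal.Quotient.mk Q y) y ⟨0, by simp⟩ ?_ ?_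
    · rintro x y ⟨a, ha⟩ ⟨b, hb⟩
      exact ⟨a + b, by rw [map_add, map_add, ha, hb]⟩
    · rintro (_ | m) x hx
      · exact ⟨⟨x, hx⟩, rfl⟩
      · exact ⟨0, by rw [map_zero, eq_comm, Ideal.Quotient.eq_zero_iff_mem]; exact hm m hx⟩
  have : IsArtinianRing (R ⧸ Q) := IsArtinianRing.of_finite k _
  exact absurd (Ring.krullDimLE_iff.mp (inferInstance : Ring.KrullDimLE 0 (R ⧸ Q)))
    (not_le.mpr (by simpa using hQ))

variable [AddCommGroup M] [Module R M] [Module k M] [IsScalarTower k R M]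
  (ℳ : ℕ → Submodule k M) [Decomposition ℳ] [SetLike.GradedSMul 𝒜 ℳ]

theorem exists_abs_relRank_gradedSpan_sub_le [IsNoetherianRing R]
    [∀ m, FiniteDimensional k (𝒜 m)] [∀ m, FiniteDimensional k (ℳ m)]
    (hstd : ∀ m : ℕ, (𝒜 (m + 1) : Set R) ⊆
      Submodule.span k (Set.image2 (· * ·) (𝒜 1 : Set R) (𝒜 m : Set R)))
    {d : ℕ} (h2 : 2 ≤ d) (hdim : ringKrullDim R = d) [Module.Finite R M]
    (A : Subalgebra k R) [IsNoetherianRing A] [IsReduced A]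
    [GradedAlgebra (subalgebraGrading 𝒜 A)] [Module.Finite A R] (hA : ringKrullDim A ≤ d)
    (Λ : Finset (PrimeSpectrum R))
    (hΛ : ∀ P : PrimeSpectrum R,
      P ∈ Λ ↔ P.asIdeal ∈ minimalPrimes R ∧ ringKrullDim (R ⧸ P.asIdeal) = d) :
    ∃ l : PrimeSpectrum R → ℕ, (∀ P ∈ Λ, localLength P.asIdeal (⊤ : Submodule R M) = l P) ∧
      ∃ C : ℕ, ∀ (ι : Type) [Fintype ι] (β : ι → A) (t : ι → ℕ) (T : ℕ), (∀ i, t i ≤ T) →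
        |(relRank ⊥ (gradedSpan ℳ β t ⊤) : ℤ) - ∑ P ∈ Λ, (l P : ℤ) *
          relRank (P.asIdeal.restrictScalars k) (gradedSpan 𝒜 β t ⊤)| ≤
          ((C * Fintype.card ι * (T + 1) ^ (d - 2) : ℕ) : ℤ) := by
  classical
  have hAM : Module.Finite A M := Module.Finite.trans R M
  refine graded_devissage 𝒜 ℳ (N₁ := ⊥) (N := ⊤) ?_ (fun _ _ _ => Submodule.mem_top) bot_le
    (fun N => ∃ l : PrimeSpectrum R → ℕ, (∀ P ∈ Λ, localLength P.asIdeal N = l P) ∧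
      ∃ C : ℕ, ∀ (ι : Type) [Fintype ι] (β : ι → A) (t : ι → ℕ) (T : ℕ), (∀ i, t i ≤ T) →
        |(relRank ⊥ (gradedSpan ℳ β t (N.restrictScalars k)) : ℤ) - ∑ P ∈ Λ, (l P : ℤ) *
          relRank (P.asIdeal.restrictScalars k) (gradedSpan 𝒜 β t ⊤)| ≤
          ((C * Fintype.card ι * (T + 1) ^ (d - 2) : ℕ) : ℤ)) ?_ ?_
  · intro n v hv
    rw [(Submodule.mem_bot R).mp hv, ← gradedProj_apply, map_zero]
    exact zero_mem _
  · refine ⟨fun _ => 0, fun P _ => by rw [localLength_bot]; rfl, 0, fun ι _ β t T _ => ?_⟩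
    rw [relRank_eq_zero]
    · simp
    · exact gradedSpan_le (B := A) (⊥ : Submodule A M)
  · rintro N' c u - - hhom hu hp hph ⟨l, hl, C, hC⟩
    have hhomN := isHomogeneous_sup ℳ hhom (isHomogeneous_span_singleton 𝒜 ℳ hu)
    have hmono : ∀ (ι : Type) [Fintype ι] (β : ι → A) (t : ι → ℕ),
        relRank ⊥ (gradedSpan ℳ β t (N'.restrictScalars k)) ≤
        relRank ⊥ (gradedSpan ℳ β t ((N' ⊔ Submodule.span R {u}).restrictScalars k)) :=
      fun ι _ β t => relRank_mono (gradedSpan_mono fun x hx => Submodule.mem_sup_left hx)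
    have hnot : ∀ P ∈ Λ, P.asIdeal ≠ annModulo N' u → ∃ s, s ∉ P.asIdeal ∧ s • u ∈ N' := by
      intro P hP hne
      have : ¬ annModulo N' u ≤ P.asIdeal := fun hle =>
        hne (le_antisymm (((hΛ P).mp hP).1.2 ⟨hp, bot_le⟩ hle) hle)
      obtain ⟨s, hs, hs'⟩ := Set.not_subset.mp this
      exact ⟨s, hs', hs⟩
    by_cases hdQ : ringKrullDim (R ⧸ annModulo N' u) < d
    · obtain ⟨C', hC'⟩ := ((growthLE_of_isPrime 𝒜 d _ hp hph hdQ).shift c).le h2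
      refine ⟨l, fun P hP => ?_, C + C', fun ι _ β t T hT => ?_⟩
      · obtain ⟨s, hs, hs'⟩ := hnot P hP (by
          intro he
          rw [← he, ((hΛ P).mp hP).2] at hdQ
          exact lt_irrefl _ hdQ)
        rw [localLength_sup_span_singleton_of_notMem _ hs hs', hl P hP]
      · have e1 := relRank_gradedSpan_le (𝒱 := ℳ) (β := β) (t := t)
          ((N' ⊔ Submodule.span R {u}).restrictScalars k) (N'.restrictScalars k) ⊥
        have e2 := sum_le_of_growth hC' hT
        simp only [← relRank_shiftPiece, ← relRank_inf_sup_span_singleton 𝒜 ℳ hhom hu] at e2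
        have e3 := hC ι β t T hT
        have e4 := hmono ι β t
        rw [add_mul, add_mul]
        rw [abs_le] at e3 ⊢
        push_cast at *
        constructor <;> lia
    · have hdQ' : ringKrullDim (R ⧸ annModulo N' u) = d :=
        le_antisymm ((ringKrullDim_quotient_le _).trans hdim.le) (not_lt.mp hdQ)
      have hmin := mem_minimalPrimes_of_not_lt hdim.le hp hdQ
      obtain ⟨x, hx, hxQ⟩ := exists_mem_one_notMem 𝒜 hstd (annModulo N' u) (by
        rw [hdQ']; exact_mod_cast (by lia : 0 < d))
      have hxc : x ^ c ∈ 𝒜 c := by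
        have := SetLike.pow_mem_graded c hx
        rwa [smul_eq_mul, mul_one] at this
      have hxcQ : x ^ c ∉ annModulo N' u := fun h => hxQ (hp.mem_of_pow_mem _ h)
      generalize hQ : annModulo N' u = Q at *
      have hQΛ : (⟨Q, hp⟩ : PrimeSpectrum R) ∈ Λ := (hΛ _).mpr ⟨hmin, hdQ'⟩
      have hsum : (Q ⊔ Ideal.span {x ^ c}).IsHomogeneous 𝒜 :=
        isHomogeneous_sup 𝒜 hph (isHomogeneous_span_singleton 𝒜 𝒜 hxc)
      obtain ⟨C', hC'⟩ := (growthLE_of_forall_lt 𝒜 hsum (d := d) (by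
        intro P hP _ hPle
        refine ringKrullDim_quotient_lt_of_lt (P := Q)
          (lt_of_le_of_ne (le_sup_left.trans hPle) ?_) d ?_
        · rintro rfl
          exact hxcQ (hPle (Ideal.mem_sup_right (Ideal.mem_span_singleton_self _)))
        · rw [hdQ']
          exact_mod_cast Nat.lt_succ_self d)).le h2
      obtain ⟨C'', hC''⟩ := relRank_gradedSpan_le_add (subalgebraGrading 𝒜 A) ℳ h2 hA
        (N₁ := N'.restrictScalars A) (N := (N' ⊔ Submodule.span R {u}).restrictScalars A)
        hhom hhomN (fun y hy => Submodule.mem_sup_left hy)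
      have hann : annModulo Q (x ^ c) = Q := by
        ext a
        rw [mem_annModulo, smul_eq_mul]
        exact ⟨fun h => (hp.mem_or_mem h).resolve_right hxcQ, fun h => Q.mul_mem_right _ h⟩
      refine ⟨fun P => l P + if P = ⟨Q, hp⟩ then 1 else 0, fun P hP => ?_, C + C' + C'',
        fun ι _ β t T hT => ?_⟩
      · dsimp only
        split_ifs with he
        · subst he
          rw [localLength_sup_span_singleton_self, hl _ hP]
          · rfl
          · intro r
            rw [← mem_annModulo, hQ]
        · obtain ⟨s, hs, hs'⟩ := hnot P hP fun h => he (PrimeSpectrum.ext h)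
          rw [localLength_sup_span_singleton_of_notMem _ hs hs', hl P hP, add_zero]
      · have e1 := relRank_gradedSpan_superadd (𝒱 := ℳ) (β := β) (t := t)
          (N₀ := ⊥) (N' := N'.restrictScalars A)
          (N := (N' ⊔ Submodule.span R {u}).restrictScalars k) bot_le
          (fun x hx => Submodule.mem_sup_left hx)
        have e2 := hC'' ι β t T hT
        have e3 := hC ι β t T hT
        have e4 := relRank_gradedSpan_sup_span_singleton 𝒜 ℳ β t hhom hu
        have e5 := relRank_gradedSpan_sup_span_singleton 𝒜 𝒜 β t hph hxc
        rw [hann] at e5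
        rw [hQ, ← e5] at e4
        have e6 := relRank_gradedSpan_le (𝒱 := 𝒜) (β := β) (t := t) ⊤
          ((Q ⊔ Ideal.span {x ^ c}).restrictScalars k) (Q.restrictScalars k)
        have e7 : relRank (Q.restrictScalars k)
            (gradedSpan 𝒜 β t ((Q ⊔ Ideal.span {x ^ c}).restrictScalars k)) ≤
            relRank (Q.restrictScalars k) (gradedSpan 𝒜 β t ⊤) :=
          relRank_mono (gradedSpan_mono le_top)
        have e8 := sum_le_of_growth hC' hT
        simp only [inf_top_eq] at e6
        have e9 : ∑ P ∈ Λ, ((l P + if P = ⟨Q, hp⟩ then 1 else 0 : ℕ) : ℤ) *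
            relRank (P.asIdeal.restrictScalars k) (gradedSpan 𝒜 β t ⊤) =
            ∑ P ∈ Λ, (l P : ℤ) *
              relRank (P.asIdeal.restrictScalars k) (gradedSpan 𝒜 β t ⊤) +
            relRank (Q.restrictScalars k) (gradedSpan 𝒜 β t ⊤) := by
          push_cast
          simp only [add_mul, Finset.sum_add_distrib, ite_mul, one_mul, zero_mul]
          rw [Finset.sum_ite_eq' Λ, if_pos hQΛ]
        rw [e9, add_mul, add_mul, add_mul, add_mul]
        change _ ≤ _ + _ + _ at e2
        simp only [Submodule.restrictScalars_restrictScalars] at *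
        rw [abs_le] at e3 ⊢
        push_cast at *
        constructor <;> lia

end Additivity

section Reduction

open MvPolynomial

variable {k σ : Type*} [Field k] [Fintype σ]

lemma totalDegree_aeval_X_le {k σ : Type*} [Field k] (a : σ) (g : Polynomial k) :
    (Polynomial.aeval (X a : MvPolynomial σ k) g).totalDegree ≤ g.natDegree := by
  rw [Polynomial.aeval_eq_sum_range]
  refine totalDegree_finsetSum_le fun i hi => ?_
  refine (totalDegree_smul_le _ _).trans ((totalDegree_pow _ _).trans ?_)
  rw [totalDegree_X, mul_one]
  exact Nat.lt_succ_iff.mp (Finset.mem_range.mp hi)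

/-- Reduction of each variable `X a` modulo the polynomial `H a`. -/
noncomputable def mvReduce (H : σ → Polynomial k) : MvPolynomial σ k →ₗ[k] MvPolynomial σ k :=
  (basisMonomials σ k).constr k fun α => ∏ a, Polynomial.aeval (X a) (Polynomial.X ^ α a %ₘ H a)

lemma mvReduce_monomial (H : σ → Polynomial k) (α : σ →₀ ℕ) :
    mvReduce H (monomial α 1) = ∏ a, Polynomial.aeval (X a) (Polynomial.X ^ α a %ₘ H a) := by
  have := (basisMonomials σ k).constr_basis k
    (fun α => ∏ a, Polynomial.aeval (X a : MvPolynomial σ k) (Polynomial.X ^ α a %ₘ H a)) α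
  rwa [coe_basisMonomials] at this

lemma mvReduce_prod (H g : σ → Polynomial k) :
    mvReduce H (∏ a, Polynomial.aeval (X a) (g a)) =
      ∏ a, Polynomial.aeval (X a) (g a %ₘ H a) := by
  classical
  let Φ : MultilinearMap k (fun _ : σ => Polynomial k) (MvPolynomial σ k) :=
    (mvReduce H).compMultilinearMap ((MultilinearMap.mkPiAlgebra k σ (MvPolynomial σ k)).compLinearMap
      fun a => (Polynomial.aeval (X a)).toLinearMap)
  let Ψ : MultilinearMap k (fun _ : σ => Polynomial k) (MvPolynomial σ k) :=
    (MultilinearMap.mkPiAlgebra k σ (MvPolynomial σ k)).compLinearMap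
      fun a => (Polynomial.aeval (X a)).toLinearMap ∘ₗ Polynomial.modByMonicHom (H a)
  have : Φ = Ψ := by
    refine Module.Basis.ext_multilinear (fun _ => Polynomial.basisMonomials k) fun α => ?_
    simp only [Φ, Ψ, LinearMap.compMultilinearMap_apply, MultilinearMap.compLinearMap_apply,
      MultilinearMap.mkPiAlgebra_apply, Polynomial.coe_basisMonomials, LinearMap.comp_apply,
      AlgHom.toLinearMap_apply, Polynomial.modByMonicHom_apply, Polynomial.monomial_one_right_eq_X_pow,
      map_pow, Polynomial.aeval_X]
    have h := mvReduce_monomial H (Finsupp.equivFunOnFinite.symm α)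
    rw [monomial_eq, map_one, one_mul, Finsupp.prod_fintype _ _ (fun _ => pow_zero _)] at h
    exact h
  exact DFunLike.congr_fun this g

lemma mvReduce_aeval_mul (H : σ → Polynomial k) (hH : ∀ a, (H a).Monic) (a : σ) (g : MvPolynomial σ k) :
    mvReduce H (Polynomial.aeval (X a) (H a) * g) = 0 := by
  classical
  have : mvReduce H ∘ₗ LinearMap.mulLeft k (Polynomial.aeval (X a) (H a)) = 0 := by
    refine (basisMonomials σ k).ext fun α => ?_
    rw [coe_basisMonomials, LinearMap.comp_apply, LinearMap.mulLeft_apply]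
    dsimp only
    rw [monomial_eq, map_one, one_mul, Finsupp.prod_fintype _ _ (fun _ => pow_zero _)]
    have h := mvReduce_prod H (fun b => (if b = a then H a else 1) * Polynomial.X ^ α b)
    simp only [map_mul, Finset.prod_mul_distrib, map_pow, Polynomial.aeval_X,
      apply_ite (Polynomial.aeval _), map_one] at h
    rw [Finset.prod_ite_eq' Finset.univ a, if_pos (Finset.mem_univ a)] at h
    rw [h, LinearMap.zero_apply]
    refine Finset.prod_eq_zero (Finset.mem_univ a) ?_
    rw [if_pos rfl, (Polynomial.modByMonic_eq_zero_iff_dvd (hH a)).mpr (dvd_mul_right _ _), map_zero]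
  exact LinearMap.congr_fun this g

lemma mem_of_forall_monomial_mem {k σ : Type*} [Field k]
    {T : Submodule k (MvPolynomial σ k)} {D : ℕ}
    (h : ∀ α : σ →₀ ℕ, α.degree ≤ D → monomial α 1 ∈ T) {g : MvPolynomial σ k}
    (hg : g.totalDegree ≤ D) : g ∈ T := by
  rw [g.as_sum]
  refine Submodule.sum_mem _ fun α hα => ?_
  rw [← mul_one (coeff α g), ← smul_eq_mul, ← smul_monomial]
  exact T.smul_mem _ (h α ((le_totalDegree hα).trans hg))

lemma totalDegree_mvReduce_le (H : σ → Polynomial k) (hH : ∀ a, (H a).Monic)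
    (g : MvPolynomial σ k) : (mvReduce H g).totalDegree ≤ ∑ a, (H a).natDegree := by
  rw [← mem_restrictTotalDegree]
  refine mem_of_forall_monomial_mem (D := g.totalDegree)
    (T := (restrictTotalDegree σ k (∑ a, (H a).natDegree)).comap (mvReduce H)) (fun α _ => ?_) le_rfl
  rw [Submodule.mem_comap, mvReduce_monomial, mem_restrictTotalDegree]
  refine (totalDegree_finsetProd _ _).trans (Finset.sum_le_sum fun a _ => ?_)
  exact (totalDegree_aeval_X_le _ _).trans (Polynomial.natDegree_modByMonic_le _ (hH a))

/-- The combinations `∑ a, H a * n a` with `n a` of total degree at most `D`. -/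
noncomputable def boundedCombos (H : σ → Polynomial k) (D : ℕ) : Submodule k (MvPolynomial σ k) :=
  (Submodule.pi Set.univ fun _ : σ => restrictTotalDegree σ k D).map
    (∑ a, LinearMap.mulLeft k (Polynomial.aeval (X a) (H a)) ∘ₗ LinearMap.proj a)

lemma mem_boundedCombos {H : σ → Polynomial k} {D : ℕ} {g : MvPolynomial σ k} :
    g ∈ boundedCombos H D ↔ ∃ n : σ → MvPolynomial σ k, (∀ a, (n a).totalDegree ≤ D) ∧
      ∑ a, Polynomial.aeval (X a) (H a) * n a = g := by
  simp [boundedCombos, Submodule.mem_pi, mem_restrictTotalDegree]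

lemma boundedCombos_mono {H : σ → Polynomial k} {D D' : ℕ} (h : D ≤ D') :
    boundedCombos H D ≤ boundedCombos H D' := by
  intro g hg
  obtain ⟨n, hn, rfl⟩ := mem_boundedCombos.mp hg
  exact mem_boundedCombos.mpr ⟨n, fun a => (hn a).trans h, rfl⟩

lemma mul_mem_boundedCombos {H : σ → Polynomial k} {D E : ℕ} {g f : MvPolynomial σ k}
    (hg : g ∈ boundedCombos H D) (hf : f.totalDegree ≤ E) : f * g ∈ boundedCombos H (E + D) := by
  obtain ⟨n, hn, rfl⟩ := mem_boundedCombos.mp hg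
  refine mem_boundedCombos.mpr ⟨fun a => f * n a, fun a =>
    (totalDegree_mul _ _).trans (add_le_add hf (hn a)), ?_⟩
  rw [Finset.mul_sum]
  exact Finset.sum_congr rfl fun a _ => by ring

lemma aeval_mul_mem_boundedCombos {H : σ → Polynomial k} {D : ℕ} {f : MvPolynomial σ k}
    (hf : f.totalDegree ≤ D) (a : σ) : Polynomial.aeval (X a) (H a) * f ∈ boundedCombos H D := by
  classical
  refine mem_boundedCombos.mpr ⟨Pi.single a f, fun b => ?_, ?_⟩
  · by_cases h : b = a
    · subst h; simpa
    · simp [h]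
  · rw [Finset.sum_eq_single a (fun b _ hb => by simp [hb]) (by simp), Pi.single_eq_same]

lemma sub_mvReduce_mem_boundedCombos (H : σ → Polynomial k) (hH : ∀ a, (H a).Monic)
    {g : MvPolynomial σ k} {D : ℕ} (hg : g.totalDegree ≤ D) :
    g - mvReduce H g ∈ boundedCombos H D := by
  classical
  refine mem_of_forall_monomial_mem
    (T := (boundedCombos H D).comap (LinearMap.id - mvReduce H)) (fun α hα => ?_) hg
  rw [Submodule.mem_comap, LinearMap.sub_apply, mvReduce_monomial, LinearMap.id_apply, monomial_eq,
    map_one, one_mul, Finsupp.prod_fintype _ _ (fun _ => pow_zero _)]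
  refine boundedCombos_mono hα ?_
  rw [Finsupp.degree_eq_sum]
  have hdeg : ∀ a, (Polynomial.aeval (X a : MvPolynomial σ k)
      (Polynomial.X ^ α a %ₘ H a)).totalDegree ≤ α a := fun a =>
    (totalDegree_aeval_X_le _ _).trans ((Polynomial.natDegree_modByMonic_le_left).trans
      (Polynomial.natDegree_X_pow_le _))
  refine Finset.induction_on (Finset.univ : Finset σ) (by simp) fun a s ha ih => ?_
  rw [Finset.prod_insert ha, Finset.prod_insert ha, Finset.sum_insert ha]
  have e : (X a : MvPolynomial σ k) ^ α a = Polynomial.aeval (X a) (Polynomial.X ^ α a %ₘ H a) +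
      Polynomial.aeval (X a) (H a) * Polynomial.aeval (X a) (Polynomial.X ^ α a /ₘ H a) := by
    rw [← map_mul, ← map_add, Polynomial.modByMonic_add_div, map_pow, Polynomial.aeval_X]
  have e' : X a ^ α a * ∏ b ∈ s, X b ^ α b - Polynomial.aeval (X a) (Polynomial.X ^ α a %ₘ H a) *
        ∏ b ∈ s, Polynomial.aeval (X b) (Polynomial.X ^ α b %ₘ H b) =
      X a ^ α a * (∏ b ∈ s, X b ^ α b -
        ∏ b ∈ s, Polynomial.aeval (X b) (Polynomial.X ^ α b %ₘ H b)) +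
      Polynomial.aeval (X a) (H a) * (Polynomial.aeval (X a) (Polynomial.X ^ α a /ₘ H a) *
        ∏ b ∈ s, Polynomial.aeval (X b : MvPolynomial σ k) (Polynomial.X ^ α b %ₘ H b)) := by
    rw [mul_sub]
    nth_rw 3 [e]
    ring
  rw [e']
  refine add_mem (mul_mem_boundedCombos ih (totalDegree_X_pow a (α a)).le)
    (aeval_mul_mem_boundedCombos ((totalDegree_mul _ _).trans (add_le_add ?_ ?_)) a)
  · refine (totalDegree_aeval_X_le _ _).trans ?_
    rw [Polynomial.natDegree_divByMonic _ (hH a), Polynomial.natDegree_X_pow]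
    exact Nat.sub_le _ _
  · exact (totalDegree_finsetProd _ _).trans (Finset.sum_le_sum fun b _ => hdeg b)

end Reduction

section Combos

open MvPolynomial

variable {k σ τ R V : Type*} [Field k] [Fintype τ] [CommRing R] [Algebra k R]
  [AddCommGroup V] [Module R V]

lemma mvReduce_eq_zero_of_mem_boundedCombos {k σ : Type*} [Field k] [Fintype σ]
    {H : σ → Polynomial k} (hH : ∀ a, (H a).Monic) {D : ℕ} {g : MvPolynomial σ k}
    (hg : g ∈ boundedCombos H D) : mvReduce H g = 0 := by
  obtain ⟨n, -, rfl⟩ := mem_boundedCombos.mp hg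
  rw [map_sum]
  exact Finset.sum_eq_zero fun a _ => mvReduce_aeval_mul H hH a _

/-- The combination `∑ j, g j (x) • e j`. -/
noncomputable def polyCombo (x : σ → R) (e : τ → V) :
    (τ → MvPolynomial σ k) →ₛₗ[(aeval x : MvPolynomial σ k →ₐ[k] R).toRingHom] V where
  toFun g := ∑ j, aeval x (g j) • e j
  map_add' g h := by simp [add_smul, Finset.sum_add_distrib]
  map_smul' s g := by simp [mul_smul, Finset.smul_sum]

lemma polyCombo_apply (x : σ → R) (e : τ → V) (g : τ → MvPolynomial σ k) :
    polyCombo x e g = ∑ j, aeval x (g j) • e j := rfl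

lemma aeval_aeval_X (x : σ → R) (a : σ) (H : Polynomial k) :
    aeval x (Polynomial.aeval (X a : MvPolynomial σ k) H) = Polynomial.aeval (x a) H := by
  rw [← Polynomial.aeval_algHom_apply, aeval_X]

lemma polyCombo_sum_mul [Fintype σ] (x : σ → R) (e : τ → V) (H : σ → Polynomial k)
    (n : σ → τ → MvPolynomial σ k) :
    polyCombo x e (fun j => ∑ a, Polynomial.aeval (X a) (H a) * n a j) =
      ∑ a, Polynomial.aeval (x a) (H a) • polyCombo x e (n a) := by
  have : (fun j => ∑ a, Polynomial.aeval (X a) (H a) * n a j) =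
      ∑ a, Polynomial.aeval (X a : MvPolynomial σ k) (H a) • n a := by
    ext1 j
    simp
  rw [this, map_sum]
  refine Finset.sum_congr rfl fun a _ => ?_
  rw [map_smulₛₗ]
  congr 1
  exact aeval_aeval_X x a (H a)

theorem exists_polyCombo_sub_sum_mem [Fintype σ] (x : σ → R) (e : τ → V)
    (he : Function.Surjective (polyCombo (k := k) x e))
    (P : σ → Polynomial k) (hP : ∀ a, (P a).Monic) (N : Submodule R V) :
    ∃ c : ℕ, ∀ (q D : ℕ) (y : τ → MvPolynomial σ k) (n : σ → V), (∀ j, (y j).totalDegree ≤ D) →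
      polyCombo x e y - ∑ a, Polynomial.aeval (x a) (P a) ^ q • n a ∈ N →
      ∃ z : σ → τ → MvPolynomial σ k,
        (∀ a j, (z a j).totalDegree ≤ D + q * ∑ a, (P a).natDegree + c) ∧
        polyCombo x e y - ∑ a, Polynomial.aeval (x a) (P a) ^ q • polyCombo x e (z a) ∈ N := by
  classical
  obtain ⟨w, κ, hκ⟩ := Submodule.fg_iff_exists_fin_generating_family.mp
    (IsNoetherian.noetherian (N.comap (polyCombo (k := k) x e)))
  refine ⟨∑ l, ∑ j, (κ l j).totalDegree, fun q D y n hy hyn => ?_⟩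
  have hκN : ∀ l, polyCombo x e (κ l) ∈ N := fun l =>
    Submodule.mem_comap.mp (hκ ▸ Submodule.subset_span (Set.mem_range_self l))
  choose n' hn' using fun a => he (n a)
  set H : σ → Polynomial k := fun a => P a ^ q with hHdef
  have hH : ∀ a, (H a).Monic := fun a => (hP a).pow q
  have hHq : ∀ a, Polynomial.aeval (x a) (P a) ^ q = Polynomial.aeval (x a) (H a) := fun a => by
    rw [hHdef, map_pow]
  have hHd : ∑ a, (H a).natDegree = q * ∑ a, (P a).natDegree := by
    rw [Finset.mul_sum]
    exact Finset.sum_congr rfl fun a _ => (hP a).natDegree_pow q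
  simp only [hHq, ← hn', ← polyCombo_sum_mul] at hyn ⊢
  rw [← map_sub, ← Submodule.mem_comap, ← hκ, Submodule.mem_span_range_iff_exists_fun] at hyn
  obtain ⟨s, hs⟩ := hyn
  have hbound : ∀ j, (y j - ∑ l, mvReduce H (s l) * κ l j).totalDegree ≤
      D + q * ∑ a, (P a).natDegree + ∑ l, ∑ j, (κ l j).totalDegree := by
    intro j
    refine (totalDegree_sub _ _).trans (max_le ((hy j).trans (by lia)) ?_)
    refine totalDegree_finsetSum_le fun l _ => (totalDegree_mul _ _).trans ?_
    have h1 := totalDegree_mvReduce_le H hH (s l)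
    have h2 : (κ l j).totalDegree ≤ ∑ l, ∑ j, (κ l j).totalDegree :=
      (Finset.single_le_sum (f := fun j => (κ l j).totalDegree) (fun _ _ => Nat.zero_le _)
        (Finset.mem_univ j)).trans (Finset.single_le_sum
          (f := fun l => ∑ j, (κ l j).totalDegree) (fun _ _ => Nat.zero_le _) (Finset.mem_univ l))
    rw [hHd] at h1
    lia
  have hcombo : ∀ j, ∃ E, y j - ∑ l, mvReduce H (s l) * κ l j ∈ boundedCombos H E := by
    intro j
    have e1 : y j = ∑ a, Polynomial.aeval (X a) (H a) * n' a j + ∑ l, s l * κ l j := by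
      have := congrFun hs j
      rw [Pi.sub_apply, Finset.sum_apply] at this
      simp only [Pi.smul_apply, smul_eq_mul] at this
      rw [this]
      ring
    have e2 : y j - ∑ l, mvReduce H (s l) * κ l j =
        ∑ a, Polynomial.aeval (X a) (H a) * n' a j +
          ∑ l, κ l j * (s l - mvReduce H (s l)) := by
      rw [e1, add_sub_assoc, ← Finset.sum_sub_distrib]
      congr 1
      exact Finset.sum_congr rfl fun l _ => by ring
    rw [e2]
    refine ⟨∑ a, (n' a j).totalDegree + ∑ l, ((κ l j).totalDegree + (s l).totalDegree),
      add_mem (sum_mem fun a _ => aeval_mul_mem_boundedCombos ?_ a) (sum_mem fun l _ =>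
        boundedCombos_mono ?_ (mul_mem_boundedCombos
          (sub_mvReduce_mem_boundedCombos H hH le_rfl) le_rfl))⟩
    · exact (Finset.single_le_sum (f := fun a => (n' a j).totalDegree) (fun _ _ => Nat.zero_le _)
        (Finset.mem_univ a)).trans (Nat.le_add_right _ _)
    · exact (Finset.single_le_sum (f := fun l => (κ l j).totalDegree + (s l).totalDegree)
        (fun _ _ => Nat.zero_le _) (Finset.mem_univ l)).trans (Nat.le_add_left _ _)
  have hz : ∀ j, ∃ z : σ → MvPolynomial σ k,
      (∀ a, (z a).totalDegree ≤ D + q * ∑ a, (P a).natDegree + ∑ l, ∑ j, (κ l j).totalDegree) ∧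
      ∑ a, Polynomial.aeval (X a) (H a) * z a = y j - ∑ l, mvReduce H (s l) * κ l j := by
    intro j
    obtain ⟨E, hE⟩ := hcombo j
    have := sub_mvReduce_mem_boundedCombos H hH (hbound j)
    rw [mvReduce_eq_zero_of_mem_boundedCombos hH hE, sub_zero] at this
    exact mem_boundedCombos.mp this
  choose z hzd hze using hz
  refine ⟨fun a j => z j a, fun a j => hzd j a, ?_⟩
  simp only [hze]
  rw [← map_sub]
  have : y - (fun j => y j - ∑ l, mvReduce H (s l) * κ l j) = ∑ l, mvReduce H (s l) • κ l := by
    ext1 j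
    simp
  rw [this, map_sum]
  refine sum_mem fun l _ => ?_
  rw [map_smulₛₗ]
  exact N.smul_mem _ (hκN l)

end Combos

section Filtration

open MvPolynomial DirectSum

variable {k R V : Type*} [Field k] [CommRing R] [Algebra k R]
  [AddCommGroup V] [Module R V] [Module k V] [IsScalarTower k R V]

/-- The elements of degree at most `D`. -/
def degreeLE {V : Type*} [AddCommGroup V] [Module k V] (𝒱 : ℕ → Submodule k V) (D : ℕ) :
    Submodule k V :=
  ⨆ n : Fin (D + 1), 𝒱 n

lemma mem_degreeLE_of_mem {V : Type*} [AddCommGroup V] [Module k V] {𝒱 : ℕ → Submodule k V}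
    {n D : ℕ} {v : V} (hv : v ∈ 𝒱 n) (h : n ≤ D) : v ∈ degreeLE 𝒱 D :=
  Submodule.mem_iSup_of_mem (p := fun n : Fin (D + 1) => 𝒱 n) ⟨n, Nat.lt_succ_iff.mpr h⟩ hv

lemma degreeLE_le {V : Type*} [AddCommGroup V] [Module k V] {𝒱 : ℕ → Submodule k V} {D : ℕ}
    {T : Submodule k V} (h : ∀ n ≤ D, 𝒱 n ≤ T) : degreeLE 𝒱 D ≤ T :=
  iSup_le fun n => h n (Nat.lt_succ_iff.mp n.2)

lemma degreeLE_mono {V : Type*} [AddCommGroup V] [Module k V] (𝒱 : ℕ → Submodule k V) {D E : ℕ}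
    (h : D ≤ E) : degreeLE 𝒱 D ≤ degreeLE 𝒱 E :=
  degreeLE_le fun _ hn _ hv => mem_degreeLE_of_mem hv (hn.trans h)

lemma exists_mem_degreeLE {V : Type*} [AddCommGroup V] [Module k V] (𝒱 : ℕ → Submodule k V)
    [Decomposition 𝒱] (v : V) : ∃ D, v ∈ degreeLE 𝒱 D := by
  refine graded_induction 𝒱 (motive := fun v => ∃ D, v ∈ degreeLE 𝒱 D) v ⟨0, zero_mem _⟩ ?_ ?_
  · rintro v w ⟨D, hD⟩ ⟨E, hE⟩
    exact ⟨max D E, add_mem (degreeLE_mono 𝒱 (le_max_left _ _) hD)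
      (degreeLE_mono 𝒱 (le_max_right _ _) hE)⟩
  · exact fun n v hv => ⟨n, mem_degreeLE_of_mem hv le_rfl⟩

variable (𝒜 : ℕ → Submodule k R) (𝒱 : ℕ → Submodule k V)

lemma smul_mem_degreeLE [SetLike.GradedSMul 𝒜 𝒱] {D E : ℕ} {a : R} {v : V}
    (ha : a ∈ degreeLE 𝒜 D) (hv : v ∈ degreeLE 𝒱 E) : a • v ∈ degreeLE 𝒱 (D + E) := by
  have h1 : degreeLE 𝒜 D ≤ (degreeLE 𝒱 (D + E)).comap
      ((LinearMap.toSpanSingleton R V v).restrictScalars k) := by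
    refine degreeLE_le fun n hn a ha => ?_
    have h2 : degreeLE 𝒱 E ≤ (degreeLE 𝒱 (D + E)).comap (Algebra.lsmul k k V a) :=
      degreeLE_le fun m hm v hv =>
        mem_degreeLE_of_mem (SetLike.GradedSMul.smul_mem ha hv : a • v ∈ 𝒱 (n + m)) (add_le_add hn hm)
    exact h2 hv
  exact h1 ha

variable [GradedAlgebra 𝒜]

lemma pow_mem_degreeLE {D : ℕ} {f : R} (hf : f ∈ degreeLE 𝒜 D) (q : ℕ) :
    f ^ q ∈ degreeLE 𝒜 (q * D) := by
  induction q with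
  | zero => 
    rw [pow_zero]
    exact mem_degreeLE_of_mem SetLike.GradedOne.one_mem (Nat.zero_le _)
  | succ q ih =>
    rw [pow_succ, add_mul, one_mul, ← smul_eq_mul]
    exact smul_mem_degreeLE 𝒜 𝒜 ih hf

lemma aeval_mem_degreeLE {σ : Type*} {x : σ → R} (hx : ∀ a, x a ∈ 𝒜 1) {D : ℕ}
    {g : MvPolynomial σ k} (hg : g.totalDegree ≤ D) : aeval x g ∈ degreeLE 𝒜 D := by
  refine mem_of_forall_monomial_mem
    (T := (degreeLE 𝒜 D).comap (aeval x).toLinearMap) (fun α hα => ?_) hg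
  rw [Submodule.mem_comap, AlgHom.toLinearMap_apply, aeval_monomial, map_one, one_mul]
  refine mem_degreeLE_of_mem (n := α.degree) ?_ hα
  rw [Finsupp.degree_apply]
  refine SetLike.prod_mem_graded _ _ _ fun a _ => ?_
  have := SetLike.pow_mem_graded (α a) (hx a)
  rwa [smul_eq_mul, mul_one] at this

/-- The combinations `∑ j, g j (x) • e j` with `g j` of total degree at most `D`. -/
noncomputable def polyComboLE {σ τ : Type*} [Fintype τ] (x : σ → R) (e : τ → V) (D : ℕ) :
    Submodule k V where
  carrier := {v | ∃ g : τ → MvPolynomial σ k, (∀ j, (g j).totalDegree ≤ D) ∧ polyCombo x e g = v}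
  zero_mem' := ⟨0, by simp, map_zero _⟩
  add_mem' := by
    rintro _ _ ⟨g, hg, rfl⟩ ⟨h, hh, rfl⟩
    exact ⟨g + h, fun j => (totalDegree_add _ _).trans (max_le (hg j) (hh j)), map_add _ _ _⟩
  smul_mem' := by
    rintro c _ ⟨g, hg, rfl⟩
    refine ⟨fun j => c • g j, fun j => (totalDegree_smul_le _ _).trans (hg j), ?_⟩
    simp only [polyCombo_apply, map_smul, smul_assoc, Finset.smul_sum]

lemma mem_polyComboLE {σ τ : Type*} [Fintype τ] {x : σ → R} {e : τ → V} {D : ℕ} {v : V} :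
    v ∈ polyComboLE (k := k) x e D ↔ ∃ g : τ → MvPolynomial σ k,
      (∀ j, (g j).totalDegree ≤ D) ∧ polyCombo x e g = v := Iff.rfl

lemma polyComboLE_mono {σ τ : Type*} [Fintype τ] (x : σ → R) (e : τ → V) {D E : ℕ} (h : D ≤ E) :
    polyComboLE (k := k) x e D ≤ polyComboLE x e E := by
  rintro _ ⟨g, hg, rfl⟩
  exact ⟨g, fun j => (hg j).trans h, rfl⟩

lemma smul_mem_polyComboLE {σ τ : Type*} [Fintype τ] {x : σ → R} {e : τ → V} {D : ℕ} {v : V}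
    (hv : v ∈ polyComboLE (k := k) x e D) (a : σ) : x a • v ∈ polyComboLE (k := k) x e (D + 1) := by
  obtain ⟨g, hg, rfl⟩ := hv
  refine ⟨(X a : MvPolynomial σ k) • g, fun j => ?_, ?_⟩
  · rw [Pi.smul_apply, smul_eq_mul, add_comm]
    exact (totalDegree_mul _ _).trans (add_le_add (totalDegree_X a).le (hg j))
  · rw [map_smulₛₗ]
    congr 1
    exact aeval_X x a

lemma self_mem_polyComboLE {σ τ : Type*} [Fintype τ] (x : σ → R) (e : τ → V) (j : τ) :
    e j ∈ polyComboLE (k := k) x e 0 := by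
  classical
  refine ⟨Pi.single j 1, fun i => ?_, ?_⟩
  · by_cases h : i = j
    · subst h; simp
    · simp [h]
  · rw [polyCombo_apply, Finset.sum_eq_single j (fun i _ hi => by simp [hi]) (by simp)]
    simp

variable [SetLike.GradedSMul 𝒜 𝒱]

lemma polyComboLE_le_degreeLE {σ τ : Type*} [Fintype τ] {x : σ → R} {e : τ → V} {c : ℕ}
    (hx : ∀ a, x a ∈ 𝒜 1) (he : ∀ j, e j ∈ degreeLE 𝒱 c) (D : ℕ) :
    polyComboLE (k := k) x e D ≤ degreeLE 𝒱 (D + c) := by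
  rintro _ ⟨g, hg, rfl⟩
  rw [polyCombo_apply]
  exact sum_mem fun j _ => smul_mem_degreeLE 𝒜 𝒱 (aeval_mem_degreeLE 𝒜 hx (hg j)) (he j)

variable [Decomposition 𝒱]

lemma exists_le_span_image2_smul [Module.Finite R V]
    (hstd : ∀ m : ℕ, (𝒜 (m + 1) : Set R) ⊆
      Submodule.span k (Set.image2 (· * ·) (𝒜 1 : Set R) (𝒜 m : Set R))) :
    ∃ c : ℕ, ∀ n, c ≤ n →
      𝒱 (n + 1) ≤ Submodule.span k (Set.image2 (· • ·) (𝒜 1 : Set R) (𝒱 n : Set V)) := by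
  classical
  obtain ⟨r, u, hu⟩ := Module.Finite.exists_fin (R := R) (M := V)
  choose D hD using fun j => exists_mem_degreeLE 𝒱 (u j)
  refine ⟨∑ j, D j, fun n hn v hv => ?_⟩
  set T := Submodule.span k (Set.image2 (· • ·) (𝒜 1 : Set R) (𝒱 n : Set V))
  obtain ⟨s, hs⟩ := (Submodule.mem_span_range_iff_exists_fun R).mp (hu ▸ Submodule.mem_top : v ∈ _)
  rw [← gradedProj_of_mem 𝒱 hv, ← hs, map_sum]
  refine sum_mem fun j _ => ?_
  have h1 : degreeLE 𝒱 (D j) ≤ T.comap (gradedProj 𝒱 (n + 1) ∘ₗ Algebra.lsmul k k V (s j)) := by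
    refine degreeLE_le fun m hm w hw => ?_
    have hm' : m ≤ n := hm.trans ((Finset.single_le_sum (f := D) (fun _ _ => Nat.zero_le _)
        (Finset.mem_univ j)).trans hn)
    rw [Submodule.mem_comap, LinearMap.comp_apply, Algebra.lsmul_coe,
      gradedProj_smul_right_of_le 𝒜 𝒱 hw (by lia)]
    have h2 : 𝒜 (n - m + 1) ≤ T.comap ((LinearMap.toSpanSingleton R V w).restrictScalars k) := by
      refine (hstd (n - m)).trans (Submodule.span_le.mpr ?_)
      rintro _ ⟨a, ha, b, hb, rfl⟩
      change (a * b) • w ∈ T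
      rw [mul_smul]
      refine Submodule.subset_span ⟨a, ha, b • w, ?_, rfl⟩
      have := gradedSMul_mem 𝒜 𝒱 hb hw
      rwa [Nat.sub_add_cancel hm'] at this
    refine h2 ?_
    rw [show n - m + 1 = n + 1 - m by lia]
    exact gradedProj_mem 𝒜 _ _
  exact h1 (hD j)

theorem exists_degreeLE_le_polyComboLE [Module.Finite R V] [∀ n, FiniteDimensional k (𝒱 n)]
    (hstd : ∀ m : ℕ, (𝒜 (m + 1) : Set R) ⊆
      Submodule.span k (Set.image2 (· * ·) (𝒜 1 : Set R) (𝒜 m : Set R)))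
    {σ : Type*} (x : σ → R) (hx : 𝒜 1 ≤ Submodule.span k (Set.range x)) :
    ∃ (c w : ℕ) (e : Fin w → V), (∀ j, e j ∈ degreeLE 𝒱 c) ∧
      ∀ D, degreeLE 𝒱 D ≤ polyComboLE (k := k) x e D := by
  obtain ⟨c, hc⟩ := exists_le_span_image2_smul 𝒜 𝒱 hstd
  have : FiniteDimensional k (degreeLE 𝒱 c) := by unfold degreeLE; infer_instance
  obtain ⟨w, e, he⟩ := Submodule.fg_iff_exists_fin_generating_family.mp
    (Module.Finite.iff_fg.mp this)
  refine ⟨c, w, e, fun j => he ▸ Submodule.subset_span (Set.mem_range_self j), fun D => ?_⟩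
  suffices h : ∀ n, 𝒱 n ≤ polyComboLE (k := k) x e n from
    degreeLE_le fun n hn => (h n).trans (polyComboLE_mono x e hn)
  have hsmall : ∀ n ≤ c, 𝒱 n ≤ polyComboLE (k := k) x e n := fun n hn v hv => by
    have h1 : v ∈ Submodule.span k (Set.range e) := he ▸ mem_degreeLE_of_mem hv hn
    refine polyComboLE_mono x e (Nat.zero_le n) (Submodule.span_le.mpr ?_ h1)
    rintro _ ⟨j, rfl⟩
    exact self_mem_polyComboLE x e j
  intro n
  induction n with
  | zero => exact hsmall 0 (Nat.zero_le _)
  | succ n ih =>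
    by_cases hn : n + 1 ≤ c
    · exact hsmall _ hn
    · refine (hc n (by lia)).trans (Submodule.span_le.mpr ?_)
      rintro _ ⟨a, ha, v, hv, rfl⟩
      have h1 : Submodule.span k (Set.range x) ≤ (polyComboLE (k := k) x e (n + 1)).comap
          ((LinearMap.toSpanSingleton R V v).restrictScalars k) := by
        refine Submodule.span_le.mpr ?_
        rintro _ ⟨b, rfl⟩
        exact smul_mem_polyComboLE (ih hv) b
      exact h1 (hx ha)

end Filtration

section Truncation

open MvPolynomial DirectSum

variable {k R V : Type*} [Field k] [CommRing R] [Algebra k R]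
  [AddCommGroup V] [Module R V] [Module k V] [IsScalarTower k R V]
  (𝒜 : ℕ → Submodule k R) [GradedAlgebra 𝒜]
  (𝒱 : ℕ → Submodule k V) [Decomposition 𝒱] [SetLike.GradedSMul 𝒜 𝒱]

theorem exists_bounded_truncation [Module.Finite R V] [∀ n, FiniteDimensional k (𝒱 n)]
    (hstd : ∀ m : ℕ, (𝒜 (m + 1) : Set R) ⊆
      Submodule.span k (Set.image2 (· * ·) (𝒜 1 : Set R) (𝒜 m : Set R)))
    {σ ι : Type*} [Fintype σ] [Fintype ι] (x : σ → R) (hx : ∀ a, x a ∈ 𝒜 1)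
    (hspan : 𝒜 1 ≤ Submodule.span k (Set.range x))
    (P : σ → Polynomial k) (hP : ∀ a, (P a).Monic) (f : ι → R) (N : Submodule R V) :
    ∃ C : ℕ, ∀ (q D : ℕ) (v : V) (u : ι ⊕ σ → V), v ∈ degreeLE 𝒱 D →
      v - ∑ i, Sum.elim f (fun a => Polynomial.aeval (x a) (P a)) i ^ q • u i ∈ N →
      ∃ u' : ι ⊕ σ → V, (∀ i, u' i ∈ degreeLE 𝒱 (D + C * (q + 1))) ∧
        v - ∑ i, Sum.elim f (fun a => Polynomial.aeval (x a) (P a)) i ^ q • u' i ∈ N := by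
  classical
  obtain ⟨c, w, e, he, hgen⟩ := exists_degreeLE_le_polyComboLE 𝒜 𝒱 hstd x hspan
  have hsurj : Function.Surjective (polyCombo (k := k) x e) := fun v => by
    obtain ⟨D, hD⟩ := exists_mem_degreeLE 𝒱 v
    obtain ⟨g, -, hg⟩ := mem_polyComboLE.mp (hgen D hD)
    exact ⟨g, hg⟩
  obtain ⟨K, hK⟩ := exists_polyCombo_sub_sum_mem x e hsurj P hP N
  choose δ' hδ' using fun i => exists_mem_degreeLE 𝒜 (f i)
  set δ := ∑ i, δ' i
  have hδ : ∀ i, f i ∈ degreeLE 𝒜 δ := fun i => degreeLE_mono 𝒜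
    (Finset.single_le_sum (f := δ') (fun _ _ => Nat.zero_le _) (Finset.mem_univ i)) (hδ' i)
  set B := ∑ a, (P a).natDegree
  refine ⟨δ + 2 * B + 2 * c + K, fun q D v u hv huv => ?_⟩
  set H : σ → Polynomial k := fun a => P a ^ q with hHdef
  have hH : ∀ a, (H a).Monic := fun a => (hP a).pow q
  have hHq : ∀ a, Polynomial.aeval (x a) (P a) ^ q = Polynomial.aeval (x a) (H a) := fun a => by
    rw [hHdef, map_pow]
  have hHd : ∑ a, (H a).natDegree = q * B := by
    rw [Finset.mul_sum]
    exact Finset.sum_congr rfl fun a _ => (hP a).natDegree_pow q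
  choose g hg using fun i => hsurj (u (Sum.inl i))
  set u₀ : ι → V := fun i => polyCombo x e fun j => mvReduce H (g i j) with hu₀
  have hu₀d : ∀ i, u₀ i ∈ degreeLE 𝒱 (q * B + c) := fun i => by
    rw [← hHd]
    exact polyComboLE_le_degreeLE 𝒜 𝒱 hx he _
      ⟨_, fun j => totalDegree_mvReduce_le H hH (g i j), rfl⟩
  have hn : ∀ i, ∃ n : σ → V,
      u (Sum.inl i) = u₀ i + ∑ a, Polynomial.aeval (x a) (P a) ^ q • n a := by
    intro i
    choose n _ hn using fun j => mem_boundedCombos.mp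
      (sub_mvReduce_mem_boundedCombos H hH (le_refl (g i j).totalDegree))
    refine ⟨fun a => polyCombo x e fun j => n j a, ?_⟩
    simp only [hHq]
    rw [← polyCombo_sum_mul x e H (fun a j => n j a), ← hg i, hu₀, ← map_add]
    congr 1
    ext1 j
    simp [hn]
  choose n hn using hn
  set v₀ := v - ∑ i, f i ^ q • u₀ i with hv₀
  have hv₀d : v₀ ∈ degreeLE 𝒱 (D + q * δ + q * B + c) := by
    refine sub_mem (degreeLE_mono 𝒱 (by lia) hv) (sum_mem fun i _ => ?_)
    exact degreeLE_mono 𝒱 (by lia)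
      (smul_mem_degreeLE 𝒜 𝒱 (pow_mem_degreeLE 𝒜 (hδ i) q) (hu₀d i))
  obtain ⟨y, hy, hyv⟩ := mem_polyComboLE.mp (hgen _ hv₀d)
  obtain ⟨z, hz, hzN⟩ := hK q _ y (fun a => u (Sum.inr a) + ∑ i, f i ^ q • n i a) hy (by
    convert huv using 1
    rw [hyv, hv₀, Fintype.sum_sum_type]
    simp only [Sum.elim_inl, Sum.elim_inr, hn, smul_add, Finset.sum_add_distrib, Finset.smul_sum]
    rw [Finset.sum_comm (s := (Finset.univ : Finset σ))]
    simp only [smul_comm (Polynomial.aeval (x _) (P _) ^ q)]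
    abel)
  refine ⟨Sum.elim u₀ fun a => polyCombo x e (z a), ?_, ?_⟩
  · rintro (i | a)
    · exact degreeLE_mono 𝒱 (by nlinarith) (hu₀d i)
    · exact degreeLE_mono 𝒱 (by nlinarith)
        (polyComboLE_le_degreeLE 𝒜 𝒱 hx he _ ⟨_, hz a, rfl⟩)
  · rw [Fintype.sum_sum_type]
    simp only [Sum.elim_inl, Sum.elim_inr]
    rwa [← sub_sub, ← hv₀, ← hyv]

end Truncation

section ResidueProjection

open DirectSum

variable {k R V : Type*} [Field k] [CommRing R] [Algebra k R]
  [AddCommGroup V] [Module R V] [Module k V] [IsScalarTower k R V]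
  (𝒜 : ℕ → Submodule k R) [GradedAlgebra 𝒜]
  (𝒱 : ℕ → Submodule k V) [Decomposition 𝒱]

/-- The projection onto the pieces of degree congruent to `r` modulo `q`. -/
noncomputable def residueProj {V : Type*} [AddCommGroup V] [Module k V] (𝒱 : ℕ → Submodule k V)
    [Decomposition 𝒱] (q r : ℕ) : V →ₗ[k] V :=
  DirectSum.toModule k ℕ V (fun n => if n % q = r then (𝒱 n).subtype else 0) ∘ₗ
    (decomposeLinearEquiv 𝒱).toLinearMap

lemma residueProj_of_mem {V : Type*} [AddCommGroup V] [Module k V] (𝒱 : ℕ → Submodule k V)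
    [Decomposition 𝒱] (q r : ℕ) {n : ℕ} {v : V} (hv : v ∈ 𝒱 n) :
    residueProj 𝒱 q r v = if n % q = r then v else 0 := by
  rw [residueProj, LinearMap.comp_apply]
  change DirectSum.toModule k ℕ V _ (decompose 𝒱 v) = _
  rw [decompose_of_mem 𝒱 hv]
  change DirectSum.toModule k ℕ V _ (DirectSum.lof k ℕ (fun n => 𝒱 n) n ⟨v, hv⟩) = _
  rw [DirectSum.toModule_lof]
  split_ifs <;> rfl

lemma residueProj_mem {k R V : Type*} [Field k] [CommRing R] [AddCommGroup V] [Module R V]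
    [Module k V] (𝒱 : ℕ → Submodule k V) [Decomposition 𝒱] (N : Submodule R V)
    (hN : N.IsHomogeneous 𝒱) (q r : ℕ) {v : V} (hv : v ∈ N) : residueProj 𝒱 q r v ∈ N := by
  obtain ⟨s, hs, -⟩ := exists_sum_gradedProj 𝒱 v
  rw [hs, map_sum]
  refine sum_mem fun n _ => ?_
  rw [residueProj_of_mem 𝒱 q r (gradedProj_mem 𝒱 n v)]
  split_ifs
  · exact hN n hv
  · exact N.zero_mem

lemma residueProj_pow_smul {k R V : Type*} [Field k] [CommRing R] [Algebra k R]
    [AddCommGroup V] [Module R V] [Module k V] (𝒜 : ℕ → Submodule k R)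
    [GradedAlgebra 𝒜] (𝒱 : ℕ → Submodule k V) [Decomposition 𝒱] [SetLike.GradedSMul 𝒜 𝒱]
    (p : ℕ) [ExpChar R p] (n r : ℕ) (f : R) (v : V) :
    residueProj 𝒱 (p ^ n) r (f ^ p ^ n • v) = f ^ p ^ n • residueProj 𝒱 (p ^ n) r v := by
  refine graded_induction 𝒜 (motive := fun f => residueProj 𝒱 (p ^ n) r (f ^ p ^ n • v) =
    f ^ p ^ n • residueProj 𝒱 (p ^ n) r v) f ?_ ?_ ?_
  · rw [zero_pow (pow_ne_zero _ (expChar_ne_zero R p))]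
    simp
  · intro f g hf hg
    rw [add_pow_expChar_pow, add_smul, add_smul, map_add, hf, hg]
  · intro j f hf
    refine graded_induction 𝒱 (motive := fun v => residueProj 𝒱 (p ^ n) r (f ^ p ^ n • v) =
      f ^ p ^ n • residueProj 𝒱 (p ^ n) r v) v (by simp)
      (fun v w hv hw => by simp [hv, hw]) fun i v hv => ?_
    have hfq : f ^ p ^ n ∈ 𝒜 (p ^ n * j) := by
      have := SetLike.pow_mem_graded (p ^ n) hf
      rwa [smul_eq_mul] at this
    rw [residueProj_of_mem 𝒱 _ _ hv, residueProj_of_mem 𝒱 _ _ (gradedSMul_mem 𝒜 𝒱 hfq hv),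
      Nat.mul_add_mod, smul_ite, smul_zero]

lemma residueProj_mem_iSup {V : Type*} [AddCommGroup V] [Module k V] (𝒱 : ℕ → Submodule k V)
    [Decomposition 𝒱] {q : ℕ} (hq : 0 < q) (r L : ℕ) {D : ℕ} (hD : D < L * q) {v : V}
    (hv : v ∈ degreeLE 𝒱 D) : residueProj 𝒱 q r v ∈ ⨆ s : Fin L, 𝒱 (r + s * q) := by
  have h : degreeLE 𝒱 D ≤ (⨆ s : Fin L, 𝒱 (r + s * q)).comap (residueProj 𝒱 q r) := by
    refine degreeLE_le fun n hn v hv => ?_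
    rw [Submodule.mem_comap, residueProj_of_mem 𝒱 _ _ hv]
    split_ifs with h
    · have hs : n / q < L := (Nat.div_lt_iff_lt_mul hq).mpr (hn.trans_lt hD)
      refine Submodule.mem_iSup_of_mem (p := fun s : Fin L => 𝒱 (r + s * q)) ⟨n / q, hs⟩ ?_
      have e : r + n / q * q = n := by rw [← h, mul_comm]; exact Nat.mod_add_div n q
      change v ∈ 𝒱 (r + n / q * q)
      rwa [e]
    · exact zero_mem _
  exact h hv

variable [SetLike.GradedSMul 𝒜 𝒱]

theorem exists_mem_iSup_sub_sum_mem [Module.Finite R V] [∀ n, FiniteDimensional k (𝒱 n)]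
    (p : ℕ) [ExpChar R p]
    (hstd : ∀ m : ℕ, (𝒜 (m + 1) : Set R) ⊆
      Submodule.span k (Set.image2 (· * ·) (𝒜 1 : Set R) (𝒜 m : Set R)))
    {σ ι : Type*} [Fintype σ] [Fintype ι] (x : σ → R) (hx : ∀ a, x a ∈ 𝒜 1)
    (hspan : 𝒜 1 ≤ Submodule.span k (Set.range x))
    (P : σ → Polynomial k) (hP : ∀ a, (P a).Monic) (f : ι → R) {N : Submodule R V}
    (hN : N.IsHomogeneous 𝒱) (C₀ : ℕ) :
    ∃ L₀ : ℕ, ∀ L ≥ L₀, ∀ (n m : ℕ) (v : V) (u : ι ⊕ σ → V), m ≤ C₀ * p ^ n → v ∈ 𝒱 m →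
      v - ∑ i, Sum.elim f (fun a => Polynomial.aeval (x a) (P a)) i ^ p ^ n • u i ∈ N →
      ∃ u' : ι ⊕ σ → V, (∀ i, u' i ∈ ⨆ s : Fin L, 𝒱 (m % p ^ n + s * p ^ n)) ∧
        v - ∑ i, Sum.elim f (fun a => Polynomial.aeval (x a) (P a)) i ^ p ^ n • u' i ∈ N := by
  obtain ⟨C, hC⟩ := exists_bounded_truncation 𝒜 𝒱 hstd x hx hspan P hP f N
  refine ⟨C₀ + 2 * C + 1, fun L hL n m v u hm hv huv => ?_⟩
  have hq : 0 < p ^ n := pow_pos (expChar_pos R p) n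
  obtain ⟨u', hu', hN'⟩ := hC (p ^ n) m v u (mem_degreeLE_of_mem hv le_rfl) huv
  refine ⟨fun i => residueProj 𝒱 (p ^ n) (m % p ^ n) (u' i), fun i =>
    residueProj_mem_iSup 𝒱 hq _ L ?_ (hu' i), ?_⟩
  · calc m + C * (p ^ n + 1) < (C₀ + 2 * C + 1) * p ^ n := by nlinarith
      _ ≤ L * p ^ n := Nat.mul_le_mul_right _ hL
  · have := residueProj_mem 𝒱 N hN (p ^ n) (m % p ^ n) hN'
    rw [map_sub, map_sum, residueProj_of_mem 𝒱 _ _ hv, if_pos rfl] at this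
    simpa only [residueProj_pow_smul 𝒜 𝒱] using this

end ResidueProjection

section PieceLength

variable {k R V : Type*} [Field k] [CommRing R] [Algebra k R]
  [AddCommGroup V] [Module R V] [Module k V] [IsScalarTower k R V]

lemma relRank_sup {W : Type*} [AddCommGroup W] [Module k W] (N X Y : Submodule k W)
    [FiniteDimensional k X] [FiniteDimensional k Y] :
    relRank N (X ⊔ Y) = relRank N X + relRank (N ⊔ X) Y := by
  have e : relRank (N ⊔ X) (X ⊔ Y) = relRank (N ⊔ X) Y := relRank_sup_of_le le_sup_right
  refine le_antisymm ?_ ?_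
  · have h := relRank_le_add N (N ⊔ X) (X ⊔ Y)
    have h' : (X ⊔ Y) ⊓ (N ⊔ X) = (X ⊔ Y) ⊓ N ⊔ X := by
      rw [inf_sup_assoc_of_le _ le_sup_left]
    rw [e, h', relRank_sup_of_le inf_le_right] at h
    lia
  · rw [← e]
    exact relRank_superadd le_sup_left le_sup_right le_sup_left

lemma relRank_eq_of_inf_le {W : Type*} [AddCommGroup W] [Module k W] {N N' X : Submodule k W}
    [FiniteDimensional k X] (h : N ≤ N') (hX : X ⊓ N' ≤ N) : relRank N X = relRank N' X := by
  refine le_antisymm ?_ (relRank_anti h)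
  have := relRank_le_add N N' X
  rwa [relRank_eq_zero hX, add_zero] at this

lemma exists_sum_smul_of_mem_span_smul_top {ι : Type*} [Fintype ι] (b : ι → R) {v : V}
    (hv : v ∈ Ideal.span (Set.range b) • (⊤ : Submodule R V)) : ∃ u : ι → V, v = ∑ i, b i • u i := by
  refine Submodule.smul_induction_on hv (fun r hr v _ => ?_) ?_
  · obtain ⟨c, rfl⟩ := Ideal.mem_span_range_iff_exists_fun.mp hr
    refine ⟨fun i => c i • v, ?_⟩
    rw [Finset.sum_smul]
    exact Finset.sum_congr rfl fun i _ => by rw [mul_comm, mul_smul]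
  · rintro _ _ ⟨u, rfl⟩ ⟨w, rfl⟩
    exact ⟨u + w, by simp [Finset.sum_add_distrib]⟩

theorem relRank_gradedSpan_option {ι : Type*} [Fintype ι] (A : Subalgebra k R)
    (𝒱 : ℕ → Submodule k V) [∀ n, FiniteDimensional k (𝒱 n)] (N : Submodule R V) (b : ι → A)
    (L : ℕ) (τ : Fin L → ℕ) (m : ℕ)
    (h : ∀ (v : V) (u : ι → V), v ∈ 𝒱 m → v - ∑ i, (b i : R) • u i ∈ N →
      ∃ u' : ι → V, (∀ i, u' i ∈ ⨆ s : Fin L, 𝒱 (τ s)) ∧ v - ∑ i, (b i : R) • u' i ∈ N) :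
    relRank (N.restrictScalars k) (gradedSpan 𝒱 (fun o : Option (ι × Fin L) =>
        o.elim (1 : A) fun c => b c.1) (fun o => o.elim m fun c => τ c.2) ⊤) =
      relRank (N.restrictScalars k)
        (gradedSpan 𝒱 (fun c : ι × Fin L => b c.1) (fun c => τ c.2) ⊤) +
      relRank ((Ideal.span (Set.range fun i => (b i : R)) • (⊤ : Submodule R V) ⊔
        N).restrictScalars k) (𝒱 m) := by
  set X := gradedSpan 𝒱 (fun c : ι × Fin L => b c.1) (fun c => τ c.2) ⊤ with hX
  have e : gradedSpan 𝒱 (fun o : Option (ι × Fin L) =>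
        o.elim (1 : A) fun c => b c.1) (fun o => o.elim m fun c => τ c.2) ⊤ = X ⊔ 𝒱 m := by
    rw [gradedSpan, iSup_option, sup_comm]
    congr 1
    simp only [Option.elim_none, map_one, inf_top_eq]
    exact Submodule.map_id _
  have hmem : ∀ i v, v ∈ ⨆ s : Fin L, 𝒱 (τ s) → (b i : R) • v ∈ X := by
    intro i v hv
    have : ⨆ s : Fin L, 𝒱 (τ s) ≤ X.comap (Algebra.lsmul k k V (b i)) := by
      refine iSup_le fun s w hw => ?_
      exact Submodule.mem_iSup_of_mem (p := fun c : ι × Fin L =>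
        (𝒱 (τ c.2) ⊓ ⊤).map (Algebra.lsmul k k V (b c.1))) (i, s) ⟨w, ⟨hw, trivial⟩, rfl⟩
    exact this hv
  rw [e, relRank_sup]
  congr 1
  refine relRank_eq_of_inf_le (sup_le ?_ ?_) ?_
  · exact fun v hv => Submodule.mem_sup_right hv
  · refine iSup_le fun c => ?_
    rintro _ ⟨v, -, rfl⟩
    exact Submodule.mem_sup_left (Submodule.smul_mem_smul
      (Ideal.subset_span (Set.mem_range_self c.1)) Submodule.mem_top)
  · rintro v ⟨hv, hv'⟩
    obtain ⟨w, hw, z, hz, rfl⟩ := Submodule.mem_sup.mp hv'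
    obtain ⟨u, rfl⟩ := exists_sum_smul_of_mem_span_smul_top _ hw
    obtain ⟨u', hu', hN⟩ := h _ u hv (by rwa [add_sub_cancel_left])
    rw [← sub_add_cancel (_ + z) (∑ i, (b i : R) • u' i)]
    exact Submodule.add_mem_sup hN (sum_mem fun i _ => hmem i _ (hu' i))

end PieceLength

section Setup

open DirectSum

variable {k R M : Type*} [Field k] [CommRing R] [Algebra k R]

lemma frobeniusPower_span_range {ι : Type*} [Fintype ι] (p : ℕ) [ExpChar R p] (F : ι → R) (n : ℕ) :
    frobeniusPower (Ideal.span (Set.range F)) (p ^ n) =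
      Ideal.span (Set.range fun i => F i ^ p ^ n) := by
  refine le_antisymm (Ideal.span_le.mpr ?_) (Ideal.span_le.mpr ?_)
  · rintro _ ⟨y, hy, rfl⟩
    obtain ⟨c, rfl⟩ := Ideal.mem_span_range_iff_exists_fun.mp hy
    change iterateFrobenius R p n (∑ i, c i * F i) ∈ _
    rw [map_sum]
    refine sum_mem fun i _ => ?_
    rw [iterateFrobenius_def, mul_pow]
    exact Ideal.mul_mem_left _ _ (Ideal.subset_span (Set.mem_range_self i))
  · rintro _ ⟨i, rfl⟩
    exact Ideal.subset_span ⟨F i, Ideal.subset_span (Set.mem_range_self i), rfl⟩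

lemma gradedPieceLength_eq_relRank [AddCommGroup M] [Module R M] [Module k M]
    [IsScalarTower k R M] (ℳ : ℕ → Submodule k M) (I : Ideal R) (q m : ℕ) :
    gradedPieceLength ℳ I q m =
      relRank ((frobeniusPower I q • (⊤ : Submodule R M) ⊔ ⊥).restrictScalars k) (ℳ m) := by
  rw [sup_bot_eq]
  refine finrank_map_eq_of_ker_eq _ _ ?_ _
  ext v
  simp

lemma quotGradedPieceLength_eq_relRank (𝒜 : ℕ → Submodule k R) (P I : Ideal R) (q m : ℕ) :
    quotGradedPieceLength 𝒜 P I q m =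
      relRank ((frobeniusPower I q • (⊤ : Submodule R R) ⊔ P).restrictScalars k) (𝒜 m) := by
  refine finrank_map_eq_of_ker_eq _ _ ?_ _
  ext v
  rw [Submodule.ker_mkQ, Submodule.restrictScalars_mem, smul_eq_mul, Ideal.mul_top,
    sup_comm (frobeniusPower I q) P]
  exact Ideal.Quotient.eq_zero_iff_mem

lemma finiteType_of_standard (𝒜 : ℕ → Submodule k R) [GradedAlgebra 𝒜]
    [∀ m, FiniteDimensional k (𝒜 m)]
    (hstd : ∀ m : ℕ, (𝒜 (m + 1) : Set R) ⊆
      Submodule.span k (Set.image2 (· * ·) (𝒜 1 : Set R) (𝒜 m : Set R))) :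
    Algebra.FiniteType k R := by
  obtain ⟨s, hs⟩ := Module.Finite.iff_fg.mp
    (inferInstance : FiniteDimensional k (𝒜 0 ⊔ 𝒜 1 : Submodule k R))
  refine ⟨⟨s, ?_⟩⟩
  have h : 𝒜 0 ⊔ 𝒜 1 ≤ Subalgebra.toSubmodule (Algebra.adjoin k (s : Set R)) :=
    hs ▸ Submodule.span_le.mpr Algebra.subset_adjoin
  have hn : ∀ n, 𝒜 n ≤ Subalgebra.toSubmodule (Algebra.adjoin k (s : Set R)) := by
    intro n
    induction n with
    | zero => exact le_sup_left.trans h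
    | succ n ih =>
      refine (hstd n).trans (Submodule.span_le.mpr ?_)
      rintro _ ⟨a, ha, b, hb, rfl⟩
      exact Subalgebra.mul_mem _ (h (Submodule.mem_sup_right ha)) (ih hb)
  refine eq_top_iff.mpr fun r _ => ?_
  exact graded_induction 𝒜 (motive := fun r => r ∈ Algebra.adjoin k (s : Set R)) r (zero_mem _)
    (fun _ _ => add_mem) fun n x hx => hn n hx

lemma isHomogeneous_of_mem_minimalPrimes (𝒜 : ℕ → Submodule k R) [GradedAlgebra 𝒜] {P : Ideal R}
    (hP : P ∈ minimalPrimes R) : P.IsHomogeneous 𝒜 := by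
  have hp : P.IsPrime := hP.1.1
  have h := hP.2 ⟨Ideal.IsPrime.homogeneousCore (𝒜 := 𝒜) hp, bot_le⟩
    (Ideal.toIdeal_homogeneousCore_le 𝒜 P)
  rw [← le_antisymm (Ideal.toIdeal_homogeneousCore_le 𝒜 P) h]
  exact HomogeneousIdeal.isHomogeneous _

lemma exists_monic_aeval_mem (I : Ideal R) [Module.Finite k (R ⧸ I)] (x : R) :
    ∃ P : Polynomial k, P.Monic ∧ Polynomial.aeval x P ∈ I := by
  obtain ⟨P, hP, h⟩ := Algebra.IsIntegral.isIntegral (R := k) (Ideal.Quotient.mk I x)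
  refine ⟨P, hP, ?_⟩
  rw [← Ideal.Quotient.eq_zero_iff_mem, ← Ideal.Quotient.mkₐ_eq_mk k,
    ← Polynomial.aeval_algHom_apply]
  exact h

lemma tendsto_div_pow_zero {p : ℕ} (hp : 1 < p) {d : ℕ} (hd : 2 ≤ d) {a : ℕ → ℝ} {K : ℕ} {e : ℕ}
    (h : ∀ n, e ≤ n → |a n| ≤ K * ((p : ℝ) ^ n) ^ (d - 2)) :
    Tendsto (fun n => a n / (p : ℝ) ^ (n * (d - 1))) atTop (𝓝 0) := by
  have hp0 : (0 : ℝ) < p := by exact_mod_cast (by lia : 0 < p)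
  have hlim : Tendsto (fun n => (K : ℝ) * ((p : ℝ)⁻¹) ^ n) atTop (𝓝 0) := by
    rw [← mul_zero (K : ℝ)]
    exact (tendsto_pow_atTop_nhds_zero_of_lt_one (inv_nonneg.mpr hp0.le)
      (inv_lt_one_of_one_lt₀ (by exact_mod_cast hp))).const_mul _
  refine squeeze_zero_norm' ?_ hlim
  filter_upwards [eventually_ge_atTop e] with n hn
  rw [Real.norm_eq_abs, abs_div, abs_of_pos (pow_pos hp0 _), div_le_iff₀ (pow_pos hp0 _)]
  refine (h n hn).trans (le_of_eq ?_)
  obtain ⟨c, rfl⟩ : ∃ c, d = c + 2 := ⟨d - 2, by lia⟩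
  rw [show c + 2 - 1 = c + 1 by lia, Nat.add_sub_cancel, pow_mul, pow_succ, inv_pow]
  field_simp

end Setup

section Assembly

open DirectSum

variable {k R V : Type*} [Field k] [CommRing R] [Algebra k R]
  [AddCommGroup V] [Module R V] [Module k V] [IsScalarTower k R V]

/-- The length of a graded piece modulo a Frobenius power, as a difference of ranks of spans with
coefficients in a subalgebra containing the `p ^ n`-th powers of the generators. -/
theorem exists_relRank_gradedSpan_option_eq (𝒜 : ℕ → Submodule k R) [GradedAlgebra 𝒜]
    (𝒱 : ℕ → Submodule k V) [SetLike.GradedSMul 𝒜 𝒱] [Decomposition 𝒱]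
    [Module.Finite R V] [∀ n, FiniteDimensional k (𝒱 n)] (p : ℕ) [ExpChar R p]
    (hstd : ∀ m : ℕ, (𝒜 (m + 1) : Set R) ⊆
      Submodule.span k (Set.image2 (· * ·) (𝒜 1 : Set R) (𝒜 m : Set R)))
    {σ ι : Type*} [Fintype σ] [Fintype ι] (x : σ → R) (hx : ∀ a, x a ∈ 𝒜 1)
    (hspan : 𝒜 1 ≤ Submodule.span k (Set.range x))
    (P : σ → Polynomial k) (hP : ∀ a, (P a).Monic) (f : ι → R) {N : Submodule R V}
    (hN : N.IsHomogeneous 𝒱) (A : Subalgebra k R) (C₀ : ℕ) :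
    ∃ L₀ : ℕ, ∀ L ≥ L₀, ∀ (n m : ℕ) (b : ι ⊕ σ → A), m ≤ C₀ * p ^ n →
      (∀ i, (b i : R) = Sum.elim f (fun a => Polynomial.aeval (x a) (P a)) i ^ p ^ n) →
      relRank (N.restrictScalars k) (gradedSpan 𝒱 (fun o : Option ((ι ⊕ σ) × Fin L) =>
          o.elim (1 : A) fun c => b c.1) (fun o => o.elim m fun c => m % p ^ n + c.2 * p ^ n) ⊤) =
        relRank (N.restrictScalars k) (gradedSpan 𝒱 (fun c : (ι ⊕ σ) × Fin L => b c.1)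
          (fun c => m % p ^ n + c.2 * p ^ n) ⊤) +
        relRank ((frobeniusPower (Ideal.span (Set.range
          (Sum.elim f fun a => Polynomial.aeval (x a) (P a)))) (p ^ n) • (⊤ : Submodule R V) ⊔
            N).restrictScalars k) (𝒱 m) := by
  obtain ⟨L₀, h⟩ := exists_mem_iSup_sub_sum_mem 𝒜 𝒱 p hstd x hx hspan P hP f hN C₀
  refine ⟨L₀, fun L hL n m b hm hb => ?_⟩
  have h' := relRank_gradedSpan_option A 𝒱 N b L (fun s => m % p ^ n + s * p ^ n) m
    fun v u hv hu => by
      simp only [hb] at hu ⊢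
      exact h L hL n m v u hm hv hu
  rw [h', frobeniusPower_span_range]
  simp only [hb]

end Assembly

/-- Additivity of the HK density function: for `Λ` the set of minimal primes `P` of `R`
with `dim R/P = d`, one has `HKd(M, I) = Σ_{P ∈ Λ} ℓ_{R_P}(M_P)·HKd(R/P, I)` (pointwise,
as limits of the approximating functions; `ℓ_{R_P}(M_P)` is the length, i.e. the Krull
dimension of the lattice of submodules, of the localization `M_P`). -/
theorem stmt16
    (k : Type*) [Field k] (p : ℕ) (hp : p.Prime) [CharP k p] [ExpChar k p] [PerfectRing k p]
    (R : Type*) [CommRing R] [IsNoetherianRing R] [Algebra k R]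
    (𝒜 : ℕ → Submodule k R) [GradedAlgebra 𝒜] [∀ m, FiniteDimensional k (𝒜 m)]
    (hstd : ∀ m : ℕ, (𝒜 (m + 1) : Set R) ⊆
      Submodule.span k (Set.image2 (· * ·) (𝒜 1 : Set R) (𝒜 m : Set R)))
    (d : ℕ) (hd : 2 ≤ d) (hdim : ringKrullDim R = d)
    (I : Ideal R) [Module.Finite k (R ⧸ I)]
    (M : Type*) [AddCommGroup M] [Module R M] [Module k M] [IsScalarTower k R M]
    [Module.Finite R M]
    (ℳ : ℕ → Submodule k M) [SetLike.GradedSMul 𝒜 ℳ] [DirectSum.Decomposition ℳ]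
    [∀ m, FiniteDimensional k (ℳ m)]
    -- `Λ` = the minimal primes `P` with `dim R/P = d`
    (Λ : Finset (PrimeSpectrum R))
    (hΛ : ∀ P : PrimeSpectrum R,
      P ∈ Λ ↔ P.asIdeal ∈ minimalPrimes R ∧ ringKrullDim (R ⧸ P.asIdeal) = d)
    -- `lam P = ℓ_{R_P}(M_P)`
    (lam : PrimeSpectrum R → ℕ)
    (hlam : ∀ P ∈ Λ, (lam P : WithBot ℕ∞) = Order.krullDim
      (Submodule (Localization P.asIdeal.primeCompl)
        (LocalizedModule P.asIdeal.primeCompl M))) :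
    ∀ x : ℝ, Tendsto
      (fun n : ℕ =>
        (gradedPieceLength ℳ I (p ^ n) (Nat.floor (x * (p : ℝ) ^ n)) : ℝ) /
            (p : ℝ) ^ (n * (d - 1))
          - ∑ P ∈ Λ, (lam P : ℝ) *
            ((quotGradedPieceLength 𝒜 P.asIdeal I (p ^ n)
                (Nat.floor (x * (p : ℝ) ^ n)) : ℝ) / (p : ℝ) ^ (n * (d - 1))))
      atTop (nhds 0) := by
  intro x
  have hR : Nontrivial R := by
    by_contra h
    rw [not_nontrivial_iff_subsingleton] at h
    rw [ringKrullDim_eq_bot_of_subsingleton] at hdim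
    exact absurd hdim (by simp)
  have hexp : ExpChar R p := expChar_of_injective_algebraMap (algebraMap k R).injective p
  have hft := finiteType_of_standard 𝒜 hstd
  obtain ⟨e, hred⟩ := exists_isReduced_powSubalgebra k p (R := R) hp.one_lt
  set A := powSubalgebra k p R e with hAdef
  have hsurj := toPowSubalgebra_surjective k p (R := R) e
  have hnoeth : IsNoetherianRing A := isNoetherianRing_of_surjective _ _ _ hsurj
  have hdimA : ringKrullDim A ≤ d := hdim ▸ ringKrullDim_le_of_surjective _ hsurj
  have hfinA : Module.Finite A R := finite_powSubalgebra k p hp.pos e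
  obtain ⟨hgr⟩ := nonempty_gradedAlgebra_subalgebraGrading 𝒜 A
    (gradedProj_mem_powSubalgebra k p 𝒜 e)
  obtain ⟨l, hl, C, hC⟩ := exists_abs_relRank_gradedSpan_sub_le 𝒜 ℳ hstd hd hdim A hdimA Λ hΛ
  have hlam' : ∀ P ∈ Λ, lam P = l P := by
    intro P hP
    have h := hlam P hP
    rw [← Module.coe_length, ← localLength_top, hl P hP] at h
    exact_mod_cast h
  obtain ⟨ν, y, hy⟩ := Submodule.fg_iff_exists_fin_generating_family.mp
    (Module.Finite.iff_fg.mp (inferInstance : FiniteDimensional k (𝒜 1)))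
  have hy1 : ∀ a, y a ∈ 𝒜 1 := fun a => hy ▸ Submodule.subset_span (Set.mem_range_self a)
  obtain ⟨μ, f, hf⟩ := Submodule.fg_iff_exists_fin_generating_family.mp
    (IsNoetherian.noetherian I)
  choose H hH hHI using fun a => exists_monic_aeval_mem (k := k) I (y a)
  set F : Fin μ ⊕ Fin ν → R := Sum.elim f fun a => Polynomial.aeval (y a) (H a) with hF
  have hI : Ideal.span (Set.range F) = I := by
    refine le_antisymm (Ideal.span_le.mpr ?_) ?_
    · rintro _ ⟨i | a, rfl⟩
      · exact hf ▸ Submodule.subset_span (Set.mem_range_self i)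
      · exact hHI a
    · rw [← hf]
      refine Submodule.span_mono ?_
      rintro _ ⟨i, rfl⟩
      exact ⟨Sum.inl i, rfl⟩
  set C₀ := ⌈|x|⌉₊ with hC₀
  have hfloor : ∀ n : ℕ, ⌊x * (p : ℝ) ^ n⌋₊ ≤ C₀ * p ^ n := by
    intro n
    refine Nat.floor_le_of_le ?_
    push_cast
    exact mul_le_mul_of_nonneg_right ((le_abs_self x).trans (Nat.le_ceil _)) (by positivity)
  obtain ⟨L₁, hL₁⟩ := exists_relRank_gradedSpan_option_eq 𝒜 ℳ p hstd y hy1 hy.ge H hH f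
    (N := ⊥) (fun n v hv => by simp [(Submodule.mem_bot R).mp hv]) A C₀
  have hLP : ∀ P : Λ, _ := fun P => exists_relRank_gradedSpan_option_eq 𝒜 𝒜 p hstd y hy1 hy.ge H hH
    f (isHomogeneous_of_mem_minimalPrimes 𝒜 ((hΛ P).mp P.2).1) A C₀
  choose L₂ hL₂ using hLP
  set L := L₁ + ∑ P, L₂ P with hL
  have hLle : ∀ P, L₂ P ≤ L := fun P =>
    (Finset.single_le_sum (f := L₂) (fun _ _ => Nat.zero_le _) (Finset.mem_univ P)).trans
      (Nat.le_add_left _ _)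
  set a : ℕ → ℤ := fun n => (gradedPieceLength ℳ I (p ^ n) ⌊x * (p : ℝ) ^ n⌋₊ : ℤ) -
    ∑ P ∈ Λ, (l P : ℤ) * quotGradedPieceLength 𝒜 P.asIdeal I (p ^ n) ⌊x * (p : ℝ) ^ n⌋₊ with ha
  set c := Fintype.card ((Fin μ ⊕ Fin ν) × Fin L) with hc
  have key : ∀ n, e ≤ n →
      |a n| ≤ ((C * (2 * c + 1) * ((C₀ + L + 1) * p ^ n) ^ (d - 2) : ℕ) : ℤ) := by
    intro n hn
    set m := ⌊x * (p : ℝ) ^ n⌋₊ with hm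
    let b : Fin μ ⊕ Fin ν → A := fun i => ⟨F i ^ p ^ n, F i ^ p ^ (n - e), by
      change (F i ^ p ^ (n - e)) ^ p ^ e = _
      rw [← pow_mul, ← pow_add, Nat.sub_add_cancel hn]⟩
    have hpn : 0 < p ^ n := pow_pos hp.pos n
    have ht : ∀ s : Fin L, m % p ^ n + s * p ^ n ≤ (C₀ + L) * p ^ n := by
      intro s
      have h1 : m % p ^ n ≤ p ^ n := (Nat.mod_lt m hpn).le
      have h2 : ((s : ℕ) + 1) * p ^ n ≤ L * p ^ n := Nat.mul_le_mul_right _ s.2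
      nlinarith
    have hm' : m ≤ (C₀ + L) * p ^ n := (hfloor n).trans (Nat.mul_le_mul_right _ (by lia))
    have e₁ := hL₁ L (by lia) n m b (hfloor n) fun i => rfl
    have e₂ := fun P : Λ => hL₂ P L (hLle P) n m b (hfloor n) fun i => rfl
    have b₁ := hC ((Fin μ ⊕ Fin ν) × Fin L) (fun c => b c.1)
      (fun c => m % p ^ n + c.2 * p ^ n) ((C₀ + L) * p ^ n) fun c => ht c.2
    have b₂ := hC (Option ((Fin μ ⊕ Fin ν) × Fin L)) (fun o => o.elim (1 : A) fun c => b c.1)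
      (fun o => o.elim m fun c => m % p ^ n + c.2 * p ^ n) ((C₀ + L) * p ^ n) fun o => by
        cases o with
        | none => exact hm'
        | some c => exact ht c.2
    rw [← hF, hI, ← gradedPieceLength_eq_relRank, Submodule.restrictScalars_bot] at e₁
    simp only [← hF, hI, ← quotGradedPieceLength_eq_relRank] at e₂
    have hsum : ∑ P ∈ Λ, (l P : ℤ) * relRank (P.asIdeal.restrictScalars k)
        (gradedSpan 𝒜 (fun o : Option ((Fin μ ⊕ Fin ν) × Fin L) => o.elim (1 : A) fun c => b c.1)
          (fun o => o.elim m fun c => m % p ^ n + c.2 * p ^ n) ⊤) =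
        ∑ P ∈ Λ, (l P : ℤ) * (relRank (P.asIdeal.restrictScalars k)
          (gradedSpan 𝒜 (fun c : (Fin μ ⊕ Fin ν) × Fin L => b c.1)
            (fun c => m % p ^ n + c.2 * p ^ n) ⊤) +
          quotGradedPieceLength 𝒜 P.asIdeal I (p ^ n) m : ℕ) :=
      Finset.sum_congr rfl fun P hP => congrArg (fun r : ℕ => (l P : ℤ) * r) (e₂ ⟨P, hP⟩)
    simp only [Nat.cast_add, mul_add, Finset.sum_add_distrib] at hsum
    rw [hsum, e₁, Fintype.card_option] at b₂
    rw [← hc] at b₁ b₂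
    have hT : (C₀ + L) * p ^ n + 1 ≤ (C₀ + L + 1) * p ^ n := by nlinarith
    have hT' := Nat.mul_le_mul_left (C * (2 * c + 1)) (Nat.pow_le_pow_left hT (d - 2))
    refine le_trans ?_ (Int.ofNat_le.mpr hT')
    rw [ha]
    push_cast at b₁ b₂ ⊢
    rw [abs_le] at b₁ b₂ ⊢
    constructor <;> linarith [b₁.1, b₁.2, b₂.1, b₂.2]
  refine (tendsto_div_pow_zero hp.one_lt hd (a := fun n => (a n : ℝ))
    (K := C * (2 * c + 1) * (C₀ + L + 1) ^ (d - 2)) (e := e) fun n hn => ?_).congr fun n => ?_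
  · have h := key n hn
    rw [mul_pow, ← mul_assoc] at h
    exact_mod_cast h
  · simp only [ha, Int.cast_sub, Int.cast_sum, Int.cast_mul, Int.cast_natCast, sub_div,
      Finset.sum_div]
    congr 1
    exact Finset.sum_congr rfl fun P hP => by rw [hlam' P hP, mul_div_assoc]
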